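/- Let R be a Cohen-Macaulay commutative noetherian ring with a dualizing module D, and let p ∈ Spec(R). Then for each injective R-module E there is an index set μ_p such that Tor_k^R(Hom_R(D, E_R(R/p)), E) = 0 for k ≠ ht(p), and Tor_k^R(Hom_R(D, E_R(R/p)), E) ≅ E_R(R/p)^{(μ_p)} (a direct sum of copies of E_R(R/p) indexed by μ_p) for k = ht(p). -/

import Mathlib

/-!
Common definitions: property t(p), injective hulls, (C-)Gorenstein injective modules,
(C-)Gorenstein injective / injective / flat dimensions, small support, torsion functor,
Tor and Ext modules, semidualizing and dualizing modules, depth, Cohen-Macaulay rings,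
Serre's condition (S₁), Gorenstein local rings, minimal injective resolutions.
-/

universe u

open CategoryTheory Limits DirectSum

noncomputable section

/-- An `R`-module `S` has property `t(p)`: multiplication by every `r ∉ p` is bijective on `S`,
and every element of `S` is annihilated by a power of `p`. -/
def PropT (R : Type u) [CommRing R] (p : Ideal R) (S : Type u) [AddCommGroup S]
    [Module R S] : Prop :=
  (∀ r : R, r ∉ p → Function.Bijective (fun s : S => r • s)) ∧
  (∀ x : S, ∃ m : ℕ, 0 < m ∧ ∀ a ∈ p ^ m, a • x = 0)

/-- `E` is an injective hull of `N` over `R`: `E` is injective and `N` embeds in `E` as an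
essential submodule. -/
def IsInjectiveHull (R : Type u) [CommRing R] (N : Type u) [AddCommGroup N] [Module R N]
    (E : Type u) [AddCommGroup E] [Module R E] : Prop :=
  Module.Injective R E ∧ ∃ ι : N →ₗ[R] E, Function.Injective ι ∧
    ∀ K : Submodule R E, K ≠ ⊥ → K ⊓ LinearMap.range ι ≠ ⊥

/-- A complete injective resolution: a doubly infinite exact sequence of injective modules
which stays exact after applying `Hom_R(-, I)` for every injective module `I`. -/
structure CompleteInjRes (R : Type u) [CommRing R] where
  E : ℤ → Type u
  [acg : ∀ i, AddCommGroup (E i)]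
  [mod : ∀ i, Module R (E i)]
  d : ∀ i, E i →ₗ[R] E (i + 1)
  inj : ∀ i, Module.Injective R (E i)
  exct : ∀ i, LinearMap.range (d i) = LinearMap.ker (d (i + 1))
  homExact : ∀ (I : Type u) [AddCommGroup I] [Module R I], Module.Injective R I →
    ∀ (i : ℤ) (g : E (i + 1) →ₗ[R] I), g ∘ₗ d i = 0 →
      ∃ h : E (i + 1 + 1) →ₗ[R] I, h ∘ₗ d (i + 1) = g

attribute [instance] CompleteInjRes.acg CompleteInjRes.mod

/-- `G` is a Gorenstein injective `R`-module: it is the image of some map in a complete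
injective resolution. -/
def GorensteinInjective (R : Type u) [CommRing R] (G : Type u) [AddCommGroup G]
    [Module R G] : Prop :=
  ∃ X : CompleteInjRes R, Nonempty (G ≃ₗ[R] LinearMap.range (X.d 0))

/-- A complete `I_C I`-resolution: an exact sequence
`⋯ → Hom(C,I₁) → Hom(C,I₀) → I⁰ → I¹ → ⋯` (terms in nonnegative degrees are injective,
terms in negative degrees are of the form `Hom_R(C, I)` with `I` injective) such that
`Hom_R(Hom_R(C,J), -)` leaves it exact for every injective `R`-module `J`. -/
structure CompleteICIRes (R : Type u) [CommRing R] (C : Type u) [AddCommGroup C]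
    [Module R C] where
  X : ℤ → Type u
  [acg : ∀ i, AddCommGroup (X i)]
  [mod : ∀ i, Module R (X i)]
  d : ∀ i, X i →ₗ[R] X (i + 1)
  exct : ∀ i, LinearMap.range (d i) = LinearMap.ker (d (i + 1))
  injPos : ∀ i : ℤ, 0 ≤ i → Module.Injective R (X i)
  homCInjNeg : ∀ i : ℤ, i < 0 → ∃ (I : Type u) (_ : AddCommGroup I) (_ : Module R I),
    Module.Injective R I ∧ Nonempty (X i ≃ₗ[R] (C →ₗ[R] I))
  homExact : ∀ (J : Type u) [AddCommGroup J] [Module R J], Module.Injective R J →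
    ∀ (i : ℤ) (g : (C →ₗ[R] J) →ₗ[R] X (i + 1)), d (i + 1) ∘ₗ g = 0 →
      ∃ h : (C →ₗ[R] J) →ₗ[R] X i, d i ∘ₗ h = g

attribute [instance] CompleteICIRes.acg CompleteICIRes.mod

/-- `G` is a `C`-Gorenstein injective `R`-module: it is the image of the map
`Hom_R(C, I₀) → I⁰` in some complete `I_C I`-resolution. -/
def CGorensteinInjective (R : Type u) [CommRing R] (C : Type u) [AddCommGroup C] [Module R C]
    (G : Type u) [AddCommGroup G] [Module R G] : Prop :=
  ∃ X : CompleteICIRes R C, Nonempty (G ≃ₗ[R] LinearMap.range (X.d (-1)))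

/-- `M` has a `C`-Gorenstein injective coresolution `0 → M → G⁰ → ⋯ → Gⁿ → 0`,
i.e. `C`-Gorenstein injective dimension at most `n`. -/
def CGidLE (R : Type u) [CommRing R] (C : Type u) [AddCommGroup C] [Module R C] :
    ℕ → ModuleCat.{u} R → Prop
  | 0, M => CGorensteinInjective R C M
  | n + 1, M => ∃ (G : ModuleCat.{u} R), CGorensteinInjective R C G ∧
      ∃ ι : M →ₗ[R] G, Function.Injective ι ∧
        CGidLE R C n (ModuleCat.of R (G ⧸ LinearMap.range ι))

/-- The `C`-Gorenstein injective dimension of `M` (equal to `⊤` if `M` admits no bounded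
coresolution by `C`-Gorenstein injective modules). -/
def CGid (R : Type u) [CommRing R] (C : Type u) [AddCommGroup C] [Module R C]
    (M : Type u) [AddCommGroup M] [Module R M] : ℕ∞ :=
  sInf {n : ℕ∞ | ∃ m : ℕ, (m : ℕ∞) = n ∧ CGidLE R C m (ModuleCat.of R M)}

/-- There exists an exact sequence `0 → N → Gₙ → ⋯ → G₁ → M → 0` in which each `Gᵢ` is
`C`-Gorenstein injective (and `N` is arbitrary). -/
def CGICoresApprox (R : Type u) [CommRing R] (C : Type u) [AddCommGroup C] [Module R C] :
    ℕ → ModuleCat.{u} R → Prop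
  | 0, _ => True
  | n + 1, M => ∃ (G : ModuleCat.{u} R), CGorensteinInjective R C G ∧
      ∃ π : G →ₗ[R] M, Function.Surjective π ∧
        CGICoresApprox R C n (ModuleCat.of R (LinearMap.ker π))

/-- The `a`-torsion submodule `Γ_a(N)` of `N`. -/
def torsionSubmodule (R : Type u) [CommRing R] (a : Ideal R) (N : Type u) [AddCommGroup N]
    [Module R N] : Submodule R N :=
  ⨆ m : ℕ, Submodule.torsionBySet R N ((a ^ m : Ideal R) : Set R)

/-- `Tor_i^R(M, N)`, as an object of `ModuleCat R`. -/
abbrev TorM (R : Type u) [CommRing R] (i : ℕ) (M N : Type u) [AddCommGroup M] [Module R M]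
    [AddCommGroup N] [Module R N] : ModuleCat.{u} R :=
  ((Tor (ModuleCat.{u} R) i).obj (ModuleCat.of R M)).obj (ModuleCat.of R N)

/-- `Ext_R^i(M, N)`, as an object of `ModuleCat R`. -/
abbrev ExtM (R : Type u) [CommRing R] (i : ℕ) (M N : Type u) [AddCommGroup M] [Module R M]
    [AddCommGroup N] [Module R N] : ModuleCat.{u} R :=
  ((Ext R (ModuleCat.{u} R) i).obj (Opposite.op (ModuleCat.of R M))).obj (ModuleCat.of R N)

/-- The small support of `M`: primes `p` such that `Tor_i^R(κ(p), M) ≠ 0` for some `i`,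
where `κ(p)` is the residue field of `R_p`. -/
def smallSupport (R : Type u) [CommRing R] (M : Type u) [AddCommGroup M] [Module R M] :
    Set (PrimeSpectrum R) :=
  {p | ∃ i : ℕ,
    Nontrivial (TorM R i (IsLocalRing.ResidueField (Localization.AtPrime p.asIdeal)) M)}

/-- `C` is a semidualizing `R`-module: finitely generated, the homothety map
`R → Hom_R(C,C)` is bijective, and `Ext_R^i(C,C) = 0` for `i ≥ 1`. -/
def IsSemidualizing (R : Type u) [CommRing R] (C : Type u) [AddCommGroup C] [Module R C] : Prop :=
  Module.Finite R C ∧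
  Function.Bijective (fun r : R => (r • LinearMap.id : C →ₗ[R] C)) ∧
  ∀ i : ℕ, 1 ≤ i → Subsingleton (ExtM R i C C)

/-- `M` has injective dimension at most `n`. -/
def InjDimLE (R : Type u) [CommRing R] : ℕ → ModuleCat.{u} R → Prop
  | 0, M => Module.Injective R M
  | n + 1, M => ∃ (I : ModuleCat.{u} R), Module.Injective R I ∧
      ∃ ι : M →ₗ[R] I, Function.Injective ι ∧
        InjDimLE R n (ModuleCat.of R (I ⧸ LinearMap.range ι))

/-- `M` has flat dimension at most `n`. -/
def FlatDimLE (R : Type u) [CommRing R] : ℕ → ModuleCat.{u} R → Prop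
  | 0, M => Module.Flat R M
  | n + 1, M => ∃ (F : ModuleCat.{u} R), Module.Flat R F ∧
      ∃ π : F →ₗ[R] M, Function.Surjective π ∧
        FlatDimLE R n (ModuleCat.of R (LinearMap.ker π))

/-- `D` is a dualizing `R`-module: semidualizing of finite injective dimension. -/
def IsDualizing (R : Type u) [CommRing R] (D : Type u) [AddCommGroup D] [Module R D] : Prop :=
  IsSemidualizing R D ∧ ∃ n : ℕ, InjDimLE R n (ModuleCat.of R D)

/-- The depth of a local ring: the supremum of lengths of regular sequences contained in
the maximal ideal. -/
def localRingDepth (A : Type u) [CommRing A] [IsLocalRing A] : ℕ∞ :=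
  sSup {n : ℕ∞ | ∃ rs : List A, (∀ r ∈ rs, r ∈ IsLocalRing.maximalIdeal A) ∧
    RingTheory.Sequence.IsRegular A rs ∧ (rs.length : ℕ∞) = n}

/-- `R` is a Cohen-Macaulay ring: for each prime `p`, `depth (R_p) = dim (R_p)`. -/
def IsCohenMacaulayRing (R : Type u) [CommRing R] : Prop :=
  ∀ (p : Ideal R) (_ : p.IsPrime),
    (localRingDepth (Localization.AtPrime p) : WithBot ℕ∞) =
      ringKrullDim (Localization.AtPrime p)

/-- Serre's condition `(S₁)`: `depth (R_p) ≥ min (ht p, 1)` for every prime `p`. -/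
def SerreS1 (R : Type u) [CommRing R] : Prop :=
  ∀ (p : Ideal R) (hp : p.IsPrime),
    min (Order.height (⟨p, hp⟩ : PrimeSpectrum R)) 1 ≤ localRingDepth (Localization.AtPrime p)

/-- A Gorenstein local ring: a noetherian local ring of finite self-injective dimension. -/
def IsGorensteinLocalRing (A : Type u) [CommRing A] : Prop :=
  IsLocalRing A ∧ IsNoetherianRing A ∧ ∃ n : ℕ, InjDimLE A n (ModuleCat.of A A)

/-- A minimal injective resolution `0 → D → J⁰ → J¹ → ⋯` of `D`: an exact sequence with all
`Jⁱ` injective, in which the kernel of each differential is an essential submodule. -/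
structure MinimalInjRes (R : Type u) [CommRing R] (D : Type u) [AddCommGroup D]
    [Module R D] where
  J : ℕ → Type u
  [acg : ∀ i, AddCommGroup (J i)]
  [mod : ∀ i, Module R (J i)]
  ε : D →ₗ[R] J 0
  d : ∀ i, J i →ₗ[R] J (i + 1)
  inj : ∀ i, Module.Injective R (J i)
  ε_inj : Function.Injective ε
  exct0 : LinearMap.range ε = LinearMap.ker (d 0)
  exct : ∀ i, LinearMap.range (d i) = LinearMap.ker (d (i + 1))
  minimal : ∀ i, ∀ K : Submodule R (J i), K ≠ ⊥ → K ⊓ LinearMap.ker (d i) ≠ ⊥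

attribute [instance] MinimalInjRes.acg MinimalInjRes.mod

end

open TensorProduct in
theorem lTensor_rTensor_comm {R : Type*} [CommRing R] {A B C E : Type*} [AddCommGroup A]
    [AddCommGroup B] [AddCommGroup C] [AddCommGroup E] [Module R A] [Module R B] [Module R C]
    [Module R E] (f : A →ₗ[R] B) (g : C →ₗ[R] E) (x : A ⊗[R] C) :
    g.lTensor B (f.rTensor C x) = f.rTensor E (g.lTensor A x) := by
  rw [← LinearMap.comp_apply, ← LinearMap.comp_apply, LinearMap.lTensor_comp_rTensor,
    LinearMap.rTensor_comp_lTensor]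

open TensorProduct in
/-- Balancing of `Tor₁`: for `0 → K → F → M → 0` and `0 → K' → F' → G → 0` exact with `F`, `F'`
flat, `ker (K ⊗ G → F ⊗ G)` and `ker (M ⊗ K' → M ⊗ F')` are isomorphic. -/
theorem nonempty_ker_rTensor_equiv_ker_lTensor {R : Type*} [CommRing R]
    {K F M K' F' G : Type*} [AddCommGroup K] [AddCommGroup F] [AddCommGroup M]
    [AddCommGroup K'] [AddCommGroup F'] [AddCommGroup G]
    [Module R K] [Module R F] [Module R M] [Module R K'] [Module R F'] [Module R G]
    [Module.Flat R F] [Module.Flat R F']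
    {i : K →ₗ[R] F} {q : F →ₗ[R] M} {i' : K' →ₗ[R] F'} {q' : F' →ₗ[R] G}
    (hi : Function.Injective i) (hq : Function.Surjective q) (hiq : Function.Exact i q)
    (hi' : Function.Injective i') (hq' : Function.Surjective q') (hiq' : Function.Exact i' q') :
    Nonempty (LinearMap.ker (i.rTensor G) ≃ₗ[R] LinearMap.ker (i'.lTensor M)) := by
  let P : Submodule R ((F ⊗[R] K') × (K ⊗[R] F')) :=
    LinearMap.eqLocus (i'.lTensor F ∘ₗ LinearMap.fst R _ _) (i.rTensor F' ∘ₗ LinearMap.snd R _ _)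
  have hP : ∀ w : P, i'.lTensor F w.1.1 = i.rTensor F' w.1.2 := fun w => w.2
  have inj1 : Function.Injective (i.rTensor F') :=
    Module.Flat.rTensor_preserves_injective_linearMap i hi
  have inj2 : Function.Injective (i'.lTensor F) :=
    Module.Flat.lTensor_preserves_injective_linearMap i' hi'
  let p1 : P →ₗ[R] LinearMap.ker (i'.lTensor M) :=
    LinearMap.codRestrict _ (q.rTensor K' ∘ₗ LinearMap.fst R _ _ ∘ₗ P.subtype) (fun w => by
      simp only [LinearMap.mem_ker, LinearMap.comp_apply, LinearMap.fst_apply,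
        Submodule.subtype_apply]
      rw [lTensor_rTensor_comm, hP, (rTensor_exact F' hiq hq).apply_apply_eq_zero])
  let p2 : P →ₗ[R] LinearMap.ker (i.rTensor G) :=
    LinearMap.codRestrict _ (q'.lTensor K ∘ₗ LinearMap.snd R _ _ ∘ₗ P.subtype) (fun w => by
      simp only [LinearMap.mem_ker, LinearMap.comp_apply, LinearMap.snd_apply,
        Submodule.subtype_apply]
      rw [← lTensor_rTensor_comm, ← hP, (lTensor_exact F hiq' hq').apply_apply_eq_zero])
  have s1 : Function.Surjective p1 := by
    rintro ⟨m, hm⟩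
    obtain ⟨w, rfl⟩ := LinearMap.rTensor_surjective K' hq m
    rw [LinearMap.mem_ker, lTensor_rTensor_comm] at hm
    obtain ⟨z, hz⟩ := ((rTensor_exact F' hiq hq) _).1 hm
    exact ⟨⟨(w, z), hz.symm⟩, rfl⟩
  have s2 : Function.Surjective p2 := by
    rintro ⟨m, hm⟩
    obtain ⟨w, rfl⟩ := LinearMap.lTensor_surjective K hq' m
    rw [LinearMap.mem_ker, ← lTensor_rTensor_comm] at hm
    obtain ⟨z, hz⟩ := ((lTensor_exact F hiq' hq') _).1 hm
    exact ⟨⟨(z, w), hz⟩, rfl⟩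
  have hk : LinearMap.ker p1 = LinearMap.ker p2 := by
    ext ⟨⟨w, z⟩, hw⟩
    have hw' : i'.lTensor F w = i.rTensor F' z := hw
    simp only [LinearMap.mem_ker, Subtype.ext_iff]
    change q.rTensor K' w = 0 ↔ q'.lTensor K z = 0
    constructor
    · intro h
      obtain ⟨y, rfl⟩ := ((rTensor_exact K' hiq hq) _).1 h
      rw [lTensor_rTensor_comm] at hw'
      rw [← inj1 hw', (lTensor_exact K hiq' hq').apply_apply_eq_zero]
    · intro h
      obtain ⟨y, rfl⟩ := ((lTensor_exact K hiq' hq') _).1 h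
      rw [← lTensor_rTensor_comm] at hw'
      rw [inj2 hw', (rTensor_exact K' hiq hq).apply_apply_eq_zero]
  exact ⟨(p2.quotKerEquivOfSurjective s2).symm ≪≫ₗ Submodule.quotEquivOfEq _ _ hk.symm ≪≫ₗ
    p1.quotKerEquivOfSurjective s1⟩

open TensorProduct in
/-- For injections `i : K → F`, `i' : K' → F'` into flat modules, the kernels of
`K ⊗ K' → F ⊗ K'` and `K ⊗ K' → K ⊗ F'` agree. -/
theorem ker_rTensor_eq_ker_lTensor {R : Type*} [CommRing R]
    {K F K' F' : Type*} [AddCommGroup K] [AddCommGroup F] [AddCommGroup K'] [AddCommGroup F']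
    [Module R K] [Module R F] [Module R K'] [Module R F'] [Module.Flat R F] [Module.Flat R F']
    {i : K →ₗ[R] F} {i' : K' →ₗ[R] F'} (hi : Function.Injective i) (hi' : Function.Injective i') :
    LinearMap.ker (i.rTensor K') = LinearMap.ker (i'.lTensor K) := by
  have h1 : LinearMap.ker (i'.lTensor F) = ⊥ :=
    LinearMap.ker_eq_bot.2 (Module.Flat.lTensor_preserves_injective_linearMap i' hi')
  have h2 : LinearMap.ker (i.rTensor F') = ⊥ :=
    LinearMap.ker_eq_bot.2 (Module.Flat.rTensor_preserves_injective_linearMap i hi)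
  rw [← LinearMap.ker_comp_of_ker_eq_bot (i.rTensor K') h1,
    ← LinearMap.ker_comp_of_ker_eq_bot (i'.lTensor K) h2, LinearMap.lTensor_comp_rTensor,
      LinearMap.rTensor_comp_lTensor]

/-- A flat resolution, recorded through its short exact sequences
`0 → X (k + 1) → F k → X k → 0`; it resolves the module `X 0`. -/
structure FlatRes (R : Type u) [CommRing R] where
  X : ℕ → Type u
  F : ℕ → Type u
  [acgX : ∀ k, AddCommGroup (X k)]
  [modX : ∀ k, Module R (X k)]
  [acgF : ∀ k, AddCommGroup (F k)]
  [modF : ∀ k, Module R (F k)]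
  [flat : ∀ k, Module.Flat R (F k)]
  π : ∀ k, F k →ₗ[R] X k
  ι : ∀ k, X (k + 1) →ₗ[R] F k
  surj : ∀ k, Function.Surjective (π k)
  inj : ∀ k, Function.Injective (ι k)
  exact : ∀ k, Function.Exact (ι k) (π k)

attribute [instance] FlatRes.acgX FlatRes.modX FlatRes.acgF FlatRes.modF FlatRes.flat

namespace FlatRes

open TensorProduct

variable {R : Type u} [CommRing R] (ρ σ : FlatRes R)

/-- `Tor_k(X 0, G)` computed from the flat resolution `ρ` of `X 0`, as a submodule of `X k ⊗ G`. -/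
def tor : (k : ℕ) → (G : Type u) → [AddCommGroup G] → [Module R G] → Submodule R (ρ.X k ⊗[R] G)
  | 0, _, _, _ => ⊤
  | k + 1, G, _, _ => LinearMap.ker ((ρ.ι k).rTensor G)

variable {A B C : Type u} [AddCommGroup A] [AddCommGroup B] [AddCommGroup C]
  [Module R A] [Module R B] [Module R C]

theorem lTensor_mem_tor (f : A →ₗ[R] B) {k : ℕ} {z : ρ.X k ⊗[R] A} (hz : z ∈ ρ.tor k A) :
    f.lTensor _ z ∈ ρ.tor k B := by
  cases k with
  | zero => trivial
  | succ k =>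
    have hz' : (ρ.ι k).rTensor A z = 0 := hz
    change (ρ.ι k).rTensor B (f.lTensor _ z) = 0
    rw [← lTensor_rTensor_comm, hz', map_zero]

/-- An element of `X k ⊗ A` lies in `Tor_k` as soon as its image along an injection does. -/
theorem mem_tor_of_lTensor_mem {f : A →ₗ[R] B} (hf : Function.Injective f) {k : ℕ}
    {z : ρ.X k ⊗[R] A} (hz : f.lTensor _ z ∈ ρ.tor k B) : z ∈ ρ.tor k A := by
  cases k with
  | zero => trivial
  | succ k =>
    have hz' : (ρ.ι k).rTensor B (f.lTensor _ z) = 0 := hz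
    change (ρ.ι k).rTensor A z = 0
    apply Module.Flat.lTensor_preserves_injective_linearMap (M := ρ.F k) f hf
    rw [map_zero, ← hz', ← LinearMap.comp_apply, ← LinearMap.comp_apply,
      LinearMap.lTensor_comp_rTensor, LinearMap.rTensor_comp_lTensor]

/-- The map induced on `Tor_k` by a linear map of coefficients. -/
noncomputable def torMap (k : ℕ) (f : A →ₗ[R] B) : ρ.tor k A →ₗ[R] ρ.tor k B :=
  (f.lTensor (ρ.X k)).restrict fun _ => ρ.lTensor_mem_tor f

@[simp] theorem coe_torMap (k : ℕ) (f : A →ₗ[R] B) (z : ρ.tor k A) :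
    (ρ.torMap k f z : ρ.X k ⊗[R] B) = f.lTensor _ z := rfl

/-- Exactness of `Tor_k(A) → Tor_k(B) → Tor_k(C)`. -/
theorem exact_torMap {f : A →ₗ[R] B} {g : B →ₗ[R] C} (hf : Function.Injective f)
    (hg : Function.Surjective g) (hfg : Function.Exact f g) (k : ℕ) {z : ρ.tor k B}
    (hz : ρ.torMap k g z = 0) : ∃ z', ρ.torMap k f z' = z := by
  obtain ⟨y, hy⟩ := ((lTensor_exact (ρ.X k) hfg hg) z.1).1 (by simpa [Subtype.ext_iff] using hz)
  exact ⟨⟨y, ρ.mem_tor_of_lTensor_mem hf (hy ▸ z.2)⟩, Subtype.ext hy⟩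

/-- If `Tor_k(A) → Tor_k(B)` is injective, then `Tor_{k+1}(B) → Tor_{k+1}(C)` is surjective. -/
theorem torMap_surjective {f : A →ₗ[R] B} {g : B →ₗ[R] C} (hf : Function.Injective f)
    (hg : Function.Surjective g) (hfg : Function.Exact f g) {k : ℕ}
    (h : Function.Injective (ρ.torMap k f)) : Function.Surjective (ρ.torMap (k + 1) g) := by
  rintro ⟨w, hw⟩
  replace hw : (ρ.ι k).rTensor C w = 0 := hw
  obtain ⟨z, rfl⟩ := LinearMap.lTensor_surjective _ hg w
  rw [← LinearMap.comp_apply, LinearMap.rTensor_comp_lTensor, ← LinearMap.lTensor_comp_rTensor,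
      LinearMap.comp_apply] at hw
  obtain ⟨y, hy⟩ := ((lTensor_exact (ρ.F k) hfg hg) _).1 hw
  have h0 : f.lTensor (ρ.X k) ((ρ.π k).rTensor A y) = 0 := by
    rw [lTensor_rTensor_comm, hy, (rTensor_exact B (ρ.exact k) (ρ.surj k)).apply_apply_eq_zero]
  have h1 : (ρ.π k).rTensor A y = 0 := by
    have hm : (ρ.π k).rTensor A y ∈ ρ.tor k A :=
      ρ.mem_tor_of_lTensor_mem hf (by rw [h0]; exact zero_mem _)
    have := @h ⟨_, hm⟩ 0 (Subtype.ext (by simpa using h0))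
    exact congrArg Subtype.val this
  obtain ⟨v, hv⟩ := ((rTensor_exact A (ρ.exact k) (ρ.surj k)) _).1 h1
  refine ⟨⟨z - f.lTensor _ v, ?_⟩, Subtype.ext ?_⟩
  · change (ρ.ι k).rTensor B _ = 0
    rw [map_sub, sub_eq_zero, ← hy, ← hv, ← LinearMap.comp_apply, ← LinearMap.comp_apply,
      LinearMap.lTensor_comp_rTensor, LinearMap.rTensor_comp_lTensor]
  · simp only [coe_torMap, map_sub]
    rw [(lTensor_exact (ρ.X (k + 1)) hfg hg).apply_apply_eq_zero, sub_zero]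

/-- If `Tor_{k+1}(C) = 0`, then `X k ⊗ A → X k ⊗ B` is injective. -/
theorem lTensor_injective {f : A →ₗ[R] B} {g : B →ₗ[R] C} (hf : Function.Injective f)
    (hg : Function.Surjective g) (hfg : Function.Exact f g) {k : ℕ} (h : ρ.tor (k + 1) C = ⊥) :
    Function.Injective (f.lTensor (ρ.X k)) := by
  rw [injective_iff_map_eq_zero]
  intro m hm
  obtain ⟨w, rfl⟩ := LinearMap.rTensor_surjective A (ρ.surj k) m
  rw [← LinearMap.comp_apply, LinearMap.lTensor_comp_rTensor, ← LinearMap.rTensor_comp_lTensor,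
      LinearMap.comp_apply] at hm
  obtain ⟨z, hz⟩ := ((rTensor_exact B (ρ.exact k) (ρ.surj k)) _).1 hm
  have h0 : g.lTensor _ z ∈ ρ.tor (k + 1) C := by
    change (ρ.ι k).rTensor C _ = 0
    rw [← lTensor_rTensor_comm, hz, (lTensor_exact (ρ.F k) hfg hg).apply_apply_eq_zero]
  rw [h, Submodule.mem_bot] at h0
  obtain ⟨y, rfl⟩ := ((lTensor_exact (ρ.X (k + 1)) hfg hg) _).1 h0
  have : (ρ.ι k).rTensor A y = w := by
    apply Module.Flat.lTensor_preserves_injective_linearMap (M := ρ.F k) f hf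
    rw [← hz, ← LinearMap.comp_apply, ← LinearMap.comp_apply,
      LinearMap.lTensor_comp_rTensor, LinearMap.rTensor_comp_lTensor]
  rw [← this, (rTensor_exact A (ρ.exact k) (ρ.surj k)).apply_apply_eq_zero]

theorem torMap_injective {f : A →ₗ[R] B} {g : B →ₗ[R] C} (hf : Function.Injective f)
    (hg : Function.Surjective g) (hfg : Function.Exact f g) {k : ℕ} (h : ρ.tor (k + 1) C = ⊥) :
    Function.Injective (ρ.torMap k f) := fun _ _ hxy =>
  Subtype.ext (ρ.lTensor_injective hf hg hfg h (congrArg Subtype.val hxy))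

theorem tor_mid {f : A →ₗ[R] B} {g : B →ₗ[R] C} (hf : Function.Injective f)
    (hg : Function.Surjective g) (hfg : Function.Exact f g) {k : ℕ} (hA : ρ.tor k A = ⊥)
    (hC : ρ.tor k C = ⊥) : ρ.tor k B = ⊥ := by
  rw [← Submodule.subsingleton_iff_eq_bot] at *
  refine subsingleton_of_forall_eq 0 fun z => ?_
  obtain ⟨y, rfl⟩ := ρ.exact_torMap hf hg hfg k (Subsingleton.elim (ρ.torMap k g z) 0)
  rw [Subsingleton.elim y 0, map_zero]

theorem tor_left {f : A →ₗ[R] B} {g : B →ₗ[R] C} (hf : Function.Injective f)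
    (hg : Function.Surjective g) (hfg : Function.Exact f g) {k : ℕ} (hB : ρ.tor k B = ⊥)
    (hC : ρ.tor (k + 1) C = ⊥) : ρ.tor k A = ⊥ := by
  have h := ρ.torMap_injective hf hg hfg hC
  rw [← Submodule.subsingleton_iff_eq_bot] at *
  exact h.subsingleton

theorem tor_right {f : A →ₗ[R] B} {g : B →ₗ[R] C} (hf : Function.Injective f)
    (hg : Function.Surjective g) (hfg : Function.Exact f g) {k : ℕ} (hB : ρ.tor (k + 1) B = ⊥)
    (hA : ρ.tor k A = ⊥) : ρ.tor (k + 1) C = ⊥ := by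
  rw [← Submodule.subsingleton_iff_eq_bot] at *
  exact (ρ.torMap_surjective hf hg hfg (Function.injective_of_subsingleton _)).subsingleton

theorem tor_succ_of_flat [Module.Flat R A] (k : ℕ) : ρ.tor (k + 1) A = ⊥ :=
  LinearMap.ker_eq_bot.2 (Module.Flat.rTensor_preserves_injective_linearMap _ (ρ.inj k))

theorem torMap_id (k : ℕ) : ρ.torMap k (LinearMap.id : A →ₗ[R] A) = LinearMap.id := by
  ext z : 2; simp

theorem torMap_comp (k : ℕ) (g : B →ₗ[R] C) (f : A →ₗ[R] B) :
    ρ.torMap k (g ∘ₗ f) = ρ.torMap k g ∘ₗ ρ.torMap k f := by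
  ext z : 2; simp [LinearMap.lTensor_comp]

theorem torMap_smul_id (k : ℕ) (r : R) (z : ρ.tor k A) :
    ρ.torMap k (r • (LinearMap.id : A →ₗ[R] A)) z = r • z := by
  ext : 1; simp

/-- Isomorphic coefficients have isomorphic `Tor_k`. -/
noncomputable def torEquiv (k : ℕ) (e : A ≃ₗ[R] B) : ρ.tor k A ≃ₗ[R] ρ.tor k B :=
  LinearEquiv.ofLinearMap (ρ.torMap k e) (ρ.torMap k e.symm)
    (by rw [← torMap_comp]; simp [torMap_id]) (by rw [← torMap_comp]; simp [torMap_id])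

theorem nonempty_ker_shift (b : ℕ) : ∀ a k : ℕ, k = a + b →
    Nonempty (LinearMap.ker ((ρ.ι a).rTensor (σ.X b)) ≃ₗ[R]
      LinearMap.ker ((ρ.ι k).rTensor (σ.X 0))) := by
  induction b with
  | zero => rintro a k rfl; exact ⟨LinearEquiv.refl _ _⟩
  | succ b ih =>
    intro a k hk
    obtain ⟨e⟩ := ih (a + 1) k (by omega)
    obtain ⟨e'⟩ := nonempty_ker_rTensor_equiv_ker_lTensor (ρ.inj (a + 1)) (ρ.surj (a + 1))
      (ρ.exact (a + 1)) (σ.inj b) (σ.surj b) (σ.exact b)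
    exact ⟨LinearEquiv.ofEq _ _ (ker_rTensor_eq_ker_lTensor (ρ.inj a) (σ.inj b)) ≪≫ₗ
      e'.symm ≪≫ₗ e⟩

/-- Symmetry of `Tor`. -/
theorem nonempty_tor_symm (k : ℕ) : Nonempty (ρ.tor k (σ.X 0) ≃ₗ[R] σ.tor k (ρ.X 0)) := by
  cases k with
  | zero => exact ⟨Submodule.topEquiv ≪≫ₗ TensorProduct.comm _ _ _ ≪≫ₗ Submodule.topEquiv.symm⟩
  | succ k =>
    obtain ⟨e⟩ := nonempty_ker_shift ρ σ k 0 k (by simp)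
    obtain ⟨e'⟩ := nonempty_ker_rTensor_equiv_ker_lTensor (ρ.inj 0) (ρ.surj 0)
      (ρ.exact 0) (σ.inj k) (σ.surj k) (σ.exact k)
    refine ⟨e.symm ≪≫ₗ e' ≪≫ₗ LinearEquiv.ofSubmodules (TensorProduct.comm _ _ _) _ _ ?_⟩
    ext z
    change _ ↔ (σ.ι k).rTensor _ z = 0
    rw [Submodule.map_equiv_eq_comap_symm, Submodule.mem_comap, LinearMap.mem_ker]
    rw [← (TensorProduct.comm R (σ.F k) (ρ.X 0)).map_eq_zero_iff]
    congr! 1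
    refine LinearMap.congr_fun (f := (σ.ι k).lTensor (ρ.X 0) ∘ₗ
      (TensorProduct.comm R (ρ.X 0) (σ.X (k + 1))).symm.toLinearMap)
      (g := (TensorProduct.comm R (σ.F k) (ρ.X 0)).toLinearMap ∘ₗ (σ.ι k).rTensor (ρ.X 0)) ?_ z
    exact TensorProduct.ext' fun _ _ => rfl

end FlatRes

namespace FlatRes

open TensorProduct

variable {R : Type u} [CommRing R]

/-- The `k`-th iterate of `next`, starting from `a`. -/
def iter {α : Type*} (next : α → α) (a : α) : ℕ → α
  | 0 => a
  | k + 1 => next (iter next a k)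

/-- The canonical resolution of `M` by free modules. -/
noncomputable def freeRes (M : Type u) [AddCommGroup M] [Module R M] : FlatRes R :=
  let next : ModuleCat.{u} R → ModuleCat.{u} R := fun M =>
    ModuleCat.of R (LinearMap.ker (Finsupp.linearCombination R (id : M → M)))
  let X := iter next (ModuleCat.of R M)
  { X := fun k => X k
    F := fun k => X k →₀ R
    π := fun _ => Finsupp.linearCombination R id
    ι := fun k => (LinearMap.ker (Finsupp.linearCombination R (id : X k → X k))).subtype
    surj := fun _ => Finsupp.linearCombination_id_surjective R _
    inj := fun _ => Subtype.val_injective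
    exact := fun _ => LinearMap.exact_subtype_ker_map _ }

theorem freeRes_projective (M : Type u) [AddCommGroup M] [Module R M] (k : ℕ) :
    Module.Projective R ((freeRes (R := R) M).F k) :=
  inferInstanceAs (Module.Projective R (_ →₀ R))

/-- A finite module over a noetherian ring has a resolution by finite free modules. -/
theorem exists_finite [IsNoetherianRing R] (M : Type u) [AddCommGroup M] [Module R M]
    [Module.Finite R M] : ∃ ρ : FlatRes R, Nonempty (ρ.X 0 ≃ₗ[R] M) ∧
      (∀ k, Module.Finite R (ρ.X k)) ∧ ∀ k, ∃ n, Nonempty (ρ.F k ≃ₗ[R] (Fin n → R)) := by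
  let α := {M : ModuleCat.{u} R // Module.Finite R M}
  have h (a : α) : ∃ (n : ℕ) (f : (Fin n → R) →ₗ[R] a.1), Function.Surjective f :=
    have := a.2; Module.Finite.exists_fin' R a.1
  choose n f hf using h
  let next : α → α := fun a => ⟨ModuleCat.of R (LinearMap.ker (f a)), inferInstance⟩
  let X := iter next ⟨ModuleCat.of R M, inferInstance⟩
  let ρ : FlatRes R :=
    { X := fun k => (X k).1
      F := fun k => Fin (n (X k)) → R
      π := fun k => f (X k)
      ι := fun k => (LinearMap.ker (f (X k))).subtype
      surj := fun _ => hf _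
      inj := fun _ => Subtype.val_injective
      exact := fun _ => LinearMap.exact_subtype_ker_map _ }
  exact ⟨ρ, ⟨LinearEquiv.refl R M⟩, fun k => (X k).2, fun k => ⟨n (X k), ⟨LinearEquiv.refl R _⟩⟩⟩

variable (ρ σ : FlatRes R)

/-- The chain complex underlying a flat resolution. -/
noncomputable def complex : ChainComplex (ModuleCat.{u} R) ℕ :=
  ChainComplex.of (fun k => ModuleCat.of R (ρ.F k))
    (fun k => ModuleCat.ofHom (ρ.ι k ∘ₗ ρ.π (k + 1))) fun k => by
      ext x
      simp [(ρ.exact (k + 1)).apply_apply_eq_zero]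

theorem complex_d (k : ℕ) :
    ρ.complex.d (k + 1) k = ModuleCat.ofHom (ρ.ι k ∘ₗ ρ.π (k + 1)) :=
  ChainComplex.of_d (fun k => ModuleCat.of R (ρ.F k))
    (fun k => ModuleCat.ofHom (ρ.ι k ∘ₗ ρ.π (k + 1))) k

theorem exact_comp (k : ℕ) :
    Function.Exact (ρ.ι (k + 1) ∘ₗ ρ.π (k + 2)) (ρ.ι k ∘ₗ ρ.π (k + 1)) := by
  intro x
  constructor
  · intro hx
    obtain ⟨y, rfl⟩ := (ρ.exact (k + 1) x).1 (ρ.inj k (by simpa using hx))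
    obtain ⟨z, rfl⟩ := ρ.surj (k + 2) y
    exact ⟨z, rfl⟩
  · rintro ⟨z, rfl⟩
    simp [(ρ.exact (k + 1)).apply_apply_eq_zero]

theorem exact_comp_zero : Function.Exact (ρ.ι 0 ∘ₗ ρ.π 1) (ρ.π 0) := by
  intro x
  constructor
  · intro hx
    obtain ⟨y, rfl⟩ := (ρ.exact 0 x).1 hx
    obtain ⟨z, rfl⟩ := ρ.surj 1 y
    exact ⟨z, rfl⟩
  · rintro ⟨z, rfl⟩
    simp [(ρ.exact 0).apply_apply_eq_zero]

theorem complex_exactAt_succ (n : ℕ) : ρ.complex.ExactAt (n + 1) := by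
  rw [HomologicalComplex.exactAt_iff' _ (n + 1 + 1) (n + 1) n (by simp) (by simp)]
  rw [ShortComplex.ShortExact.moduleCat_exact_iff_function_exact]
  change Function.Exact (ρ.complex.d (n + 1 + 1) (n + 1)) (ρ.complex.d (n + 1) n)
  rw [complex_d, complex_d]
  exact ρ.exact_comp n

/-- The augmentation of the chain complex underlying a flat resolution. -/
noncomputable def augmentation :
    ρ.complex ⟶ (ChainComplex.single₀ (ModuleCat.{u} R)).obj (ModuleCat.of R (ρ.X 0)) :=
  (ChainComplex.toSingle₀Equiv _ _).symm ⟨ModuleCat.ofHom (ρ.π 0), by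
    rw [complex_d]
    exact ModuleCat.hom_ext ρ.exact_comp_zero.linearMap_comp_eq_zero⟩

theorem augmentation_f_zero : ρ.augmentation.f 0 = ModuleCat.ofHom (ρ.π 0) :=
  ChainComplex.toSingle₀Equiv_symm_apply_f_zero _ _

/-- A flat resolution by projectives as a projective resolution. -/
noncomputable def projectiveResolution (h : ∀ k, Module.Projective R (ρ.F k)) :
    ProjectiveResolution (ModuleCat.of R (ρ.X 0)) where
  complex := ρ.complex
  projective k := (IsProjective.iff_projective (R := R) (ρ.F k)).1 (h k)
  π := ρ.augmentation
  quasiIso := ⟨fun n => by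
    cases n
    · rw [ChainComplex.quasiIsoAt₀_iff, ShortComplex.quasiIso_iff_of_zeros']
      · constructor
        · rw [ShortComplex.ShortExact.moduleCat_exact_iff_function_exact]
          change Function.Exact (ρ.complex.d 1 0).hom (ρ.augmentation.f 0).hom
          rw [complex_d, augmentation_f_zero]
          exact ρ.exact_comp_zero
        · refine (ModuleCat.epi_iff_surjective (ρ.augmentation.f 0)).2 ?_
          rw [augmentation_f_zero]
          exact ρ.surj 0
      all_goals rfl
    · rw [quasiIsoAt_iff_exactAt']
      · apply complex_exactAt_succ
      · apply ChainComplex.exactAt_succ_single_obj⟩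

/-- `Ext` vanishing makes maps out of syzygies extend. -/
theorem exists_extension_of_ext (h : ∀ k, Module.Projective R (ρ.F k)) (Y : Type u)
    [AddCommGroup Y] [Module R Y] (k : ℕ) (hE : Subsingleton (ExtM R (k + 1) (ρ.X 0) Y))
    (f : ρ.X (k + 1) →ₗ[R] Y) : ∃ g : ρ.F k →ₗ[R] Y, g ∘ₗ ρ.ι k = f := by
  let P := ρ.projectiveResolution h
  let K := P.complex.linearYonedaObj R (ModuleCat.of R Y)
  have h1 : K.ExactAt (k + 1) := by
    rw [HomologicalComplex.exactAt_iff_isZero_homology]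
    exact (ModuleCat.isZero_of_subsingleton _).of_iso
      (P.isoExt (R := R) (k + 1) (ModuleCat.of R Y)).symm
  rw [HomologicalComplex.exactAt_iff' _ k (k + 1) (k + 2) (by simp) (by simp),
    ShortComplex.moduleCat_exact_iff] at h1
  obtain ⟨g, hg⟩ := h1 (ModuleCat.ofHom (f ∘ₗ ρ.π (k + 1))) (by
    change ρ.complex.d (k + 2) (k + 1) ≫ _ = 0
    rw [complex_d]
    refine ModuleCat.hom_ext (LinearMap.ext fun x => ?_)
    change f (ρ.π (k + 1) (ρ.ι (k + 1) (ρ.π (k + 2) x))) = 0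
    rw [(ρ.exact (k + 1)).apply_apply_eq_zero, map_zero])
  refine ⟨g.hom, LinearMap.ext fun x => ?_⟩
  obtain ⟨x, rfl⟩ := ρ.surj (k + 1) x
  replace hg : ρ.complex.d (k + 1) k ≫ g = ModuleCat.ofHom (f ∘ₗ ρ.π (k + 1)) := hg
  rw [complex_d] at hg
  exact LinearMap.congr_fun (ModuleCat.hom_ext_iff.1 hg) x

/-- Comparison of `tor` with the `Tor` of Mathlib. -/
theorem nonempty_torM_equiv (h : ∀ k, Module.Projective R (ρ.F k)) (N : Type u)
    [AddCommGroup N] [Module R N] (k : ℕ) : Nonempty (TorM R k N (ρ.X 0) ≃ₗ[R] ρ.tor k N) := by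
  cases k with
  | zero =>
    let e := ((MonoidalCategory.tensoringLeft (ModuleCat.{u} R)).obj
      (ModuleCat.of R N)).leftDerivedZeroIsoSelf.app (ModuleCat.of R (ρ.X 0))
    exact ⟨e.toLinearEquiv ≪≫ₗ TensorProduct.comm R N (ρ.X 0) ≪≫ₗ Submodule.topEquiv.symm⟩
  | succ k =>
    let P := ρ.projectiveResolution h
    let T := (MonoidalCategory.tensoringLeft (ModuleCat.{u} R)).obj (ModuleCat.of R N)
    let K := (T.mapHomologicalComplex _).obj P.complex
    have hd (n : ℕ) : (K.d (n + 1) n).hom = (ρ.ι n ∘ₗ ρ.π (n + 1)).lTensor N := by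
      change (T.map (ρ.complex.d (n + 1) n)).hom = _
      rw [complex_d]
      rfl
    let e₁ : TorM R (k + 1) N (ρ.X 0) ≅ K.homology (k + 1) := P.isoLeftDerivedObj T (k + 1)
    let e₂ : K.homology (k + 1) ≅ (K.sc' (k + 2) (k + 1) k).homology :=
      K.homologyIsoSc' _ _ _ (by simp) (by simp)
    let S := K.sc' (k + 2) (k + 1) k
    have hS : S.g.hom = (ρ.ι k ∘ₗ ρ.π (k + 1)).lTensor N := hd k
    have hS' : S.f.hom = (ρ.ι (k + 1) ∘ₗ ρ.π (k + 2)).lTensor N := hd (k + 1)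
    have hcomm (z : N ⊗[R] ρ.X (k + 1)) : (ρ.ι k).rTensor N (TensorProduct.comm R _ _ z) =
        TensorProduct.comm R _ _ ((ρ.ι k).lTensor N z) :=
      LinearMap.congr_fun (f := (ρ.ι k).rTensor N ∘ₗ (TensorProduct.comm R _ _).toLinearMap)
        (g := (TensorProduct.comm R _ _).toLinearMap ∘ₗ (ρ.ι k).lTensor N)
        (TensorProduct.ext' fun _ _ => rfl) z
    let q : LinearMap.ker S.g.hom →ₗ[R] ρ.tor (k + 1) N :=
      LinearMap.codRestrict (ρ.tor (k + 1) N) ((TensorProduct.comm R _ _).toLinearMap ∘ₗ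
        (ρ.π (k + 1)).lTensor N ∘ₗ (LinearMap.ker S.g.hom).subtype) (by
          rintro ⟨z, hz⟩
          rw [LinearMap.mem_ker, hS, LinearMap.lTensor_comp] at hz
          change (ρ.ι k).rTensor N (TensorProduct.comm R _ _ ((ρ.π (k + 1)).lTensor N z)) = 0
          rw [hcomm]
          exact (congrArg _ hz).trans (map_zero _))
    have hq : Function.Surjective q := by
      rintro ⟨w, hw⟩
      obtain ⟨w, rfl⟩ := (TensorProduct.comm R N (ρ.X (k + 1))).surjective w
      obtain ⟨z, rfl⟩ := LinearMap.lTensor_surjective N (ρ.surj (k + 1)) w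
      refine ⟨⟨z, ?_⟩, rfl⟩
      change (ρ.ι k).rTensor N _ = 0 at hw
      rw [hcomm, LinearEquiv.map_eq_zero_iff] at hw
      have : S.g.hom z = (ρ.ι k).lTensor N ((ρ.π (k + 1)).lTensor N z) := by
        rw [hS, LinearMap.lTensor_comp]
        rfl
      exact this.trans hw
    have hker : LinearMap.range S.moduleCatToCycles = LinearMap.ker q := by
      ext ⟨z, hz⟩
      constructor
      · rintro ⟨y, hy⟩
        have hy' : z = (ρ.ι (k + 1) ∘ₗ ρ.π (k + 2)).lTensor N y := by
          rw [← hS']; exact (congrArg Subtype.val hy).symm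
        refine Subtype.ext ?_
        change TensorProduct.comm R _ _ ((ρ.π (k + 1)).lTensor N z) = 0
        have h0 : (ρ.π (k + 1)).lTensor N ∘ₗ (ρ.ι (k + 1) ∘ₗ ρ.π (k + 2)).lTensor N = 0 := by
          rw [← LinearMap.lTensor_comp, ← LinearMap.comp_assoc,
            (ρ.exact (k + 1)).linearMap_comp_eq_zero, LinearMap.zero_comp, LinearMap.lTensor_zero]
        rw [hy']
        exact (congrArg _ (LinearMap.congr_fun h0 y)).trans (map_zero _)
      · intro hq0
        have hz0 : TensorProduct.comm R _ _ ((ρ.π (k + 1)).lTensor N z) = 0 :=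
          congrArg Subtype.val hq0
        rw [LinearEquiv.map_eq_zero_iff] at hz0
        obtain ⟨y, hy⟩ := ((lTensor_exact N (ρ.exact (k + 1)) (ρ.surj (k + 1))) _).1 hz0
        obtain ⟨x, rfl⟩ := LinearMap.lTensor_surjective N (ρ.surj (k + 2)) y
        refine ⟨x, Subtype.ext ?_⟩
        change S.f.hom x = z
        rw [hS', LinearMap.lTensor_comp]
        exact hy
    exact ⟨(e₁ ≪≫ e₂ ≪≫ S.moduleCatHomologyIso).toLinearEquiv ≪≫ₗ
      Submodule.quotEquivOfEq _ _ hker ≪≫ₗ q.quotKerEquivOfSurjective hq⟩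

end FlatRes

/-- Vanishing of `Tor_k(M, L)`. -/
def TorVanishes (R : Type u) [CommRing R] (k : ℕ) (M L : Type u) [AddCommGroup M] [Module R M]
    [AddCommGroup L] [Module R L] : Prop :=
  (FlatRes.freeRes (R := R) M).tor k L = ⊥

section TorVanishes

open TensorProduct

variable {R : Type u} [CommRing R] {M M' L L' L'' : Type u} [AddCommGroup M] [AddCommGroup M']
  [AddCommGroup L] [AddCommGroup L'] [AddCommGroup L''] [Module R M] [Module R M'] [Module R L]
  [Module R L'] [Module R L''] {k : ℕ}

theorem nonempty_freeRes_tor_symm (R : Type u) [CommRing R] (M L : Type u) [AddCommGroup M]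
    [Module R M] [AddCommGroup L] [Module R L] (k : ℕ) :
    Nonempty ((FlatRes.freeRes (R := R) M).tor k L ≃ₗ[R] (FlatRes.freeRes (R := R) L).tor k M) :=
  FlatRes.nonempty_tor_symm (FlatRes.freeRes (R := R) M) (FlatRes.freeRes (R := R) L) k

theorem nonempty_torM_equiv_freeRes (R : Type u) [CommRing R] (M L : Type u) [AddCommGroup M]
    [Module R M] [AddCommGroup L] [Module R L] (k : ℕ) :
    Nonempty (TorM R k M L ≃ₗ[R] (FlatRes.freeRes (R := R) M).tor k L) := by
  obtain ⟨e⟩ : Nonempty (TorM R k M L ≃ₗ[R] (FlatRes.freeRes (R := R) L).tor k M) :=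
    (FlatRes.freeRes (R := R) L).nonempty_torM_equiv (FlatRes.freeRes_projective L) M k
  obtain ⟨e'⟩ := nonempty_freeRes_tor_symm R L M k
  exact ⟨e ≪≫ₗ e'⟩

theorem torVanishes_iff_subsingleton :
    TorVanishes R k M L ↔ Subsingleton ((FlatRes.freeRes (R := R) M).tor k L) :=
  Submodule.subsingleton_iff_eq_bot.symm

theorem TorVanishes.symm (h : TorVanishes R k M L) : TorVanishes R k L M := by
  rw [torVanishes_iff_subsingleton] at *
  obtain ⟨e⟩ := nonempty_freeRes_tor_symm R L M k
  exact e.subsingleton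

theorem TorVanishes.congr_right (h : TorVanishes R k M L) (e : L ≃ₗ[R] L') :
    TorVanishes R k M L' := by
  rw [torVanishes_iff_subsingleton] at *
  exact ((FlatRes.freeRes (R := R) M).torEquiv k e).symm.subsingleton

theorem torVanishes_iff (ρ : FlatRes R) (e : ρ.X 0 ≃ₗ[R] M) :
    TorVanishes R k M L ↔ ρ.tor k L = ⊥ := by
  obtain ⟨e'⟩ : Nonempty (ρ.tor k L ≃ₗ[R] (FlatRes.freeRes (R := R) L).tor k (ρ.X 0)) :=
    FlatRes.nonempty_tor_symm ρ (FlatRes.freeRes (R := R) L) k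
  rw [← Submodule.subsingleton_iff_eq_bot, e'.toEquiv.subsingleton_congr,
    ← torVanishes_iff_subsingleton]
  exact ⟨fun h => h.symm.congr_right e.symm, fun h => (h.congr_right e).symm⟩

theorem torVanishes_of_subsingleton [Subsingleton L] : TorVanishes R k M L := by
  rw [torVanishes_iff_subsingleton]
  have : Subsingleton ((FlatRes.freeRes (R := R) M).X k ⊗[R] L) :=
    subsingleton_of_forall_eq 0 fun z => by
      induction z using TensorProduct.induction_on with
      | zero => rfl
      | tmul x y => rw [Subsingleton.elim y 0, TensorProduct.tmul_zero]
      | add x y hx hy => rw [hx, hy, add_zero]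
  infer_instance

theorem torVanishes_succ_of_flat [Module.Flat R L] : TorVanishes R (k + 1) M L :=
  FlatRes.tor_succ_of_flat _ _

section LES

variable {f : L →ₗ[R] L'} {g : L' →ₗ[R] L''} (hf : Function.Injective f)
  (hg : Function.Surjective g) (hfg : Function.Exact f g)
include hf hg hfg

theorem TorVanishes.mid (h : TorVanishes R k M L) (h'' : TorVanishes R k M L'') :
    TorVanishes R k M L' := FlatRes.tor_mid _ hf hg hfg h h''

theorem TorVanishes.left (h : TorVanishes R k M L') (h'' : TorVanishes R (k + 1) M L'') :
    TorVanishes R k M L := FlatRes.tor_left _ hf hg hfg h h''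

theorem TorVanishes.right (h : TorVanishes R (k + 1) M L') (h'' : TorVanishes R k M L) :
    TorVanishes R (k + 1) M L'' := FlatRes.tor_right _ hf hg hfg h h''

end LES

/-- Every element is killed by a power of `s`. -/
def IsPowTorsion (s : R) (M : Type*) [AddCommGroup M] [Module R M] : Prop :=
  ∀ x : M, ∃ m : ℕ, s ^ m • x = 0

theorem IsPowTorsion.tensorProduct {s : R} (h : IsPowTorsion s M) : IsPowTorsion s (L ⊗[R] M) := by
  intro z
  induction z using TensorProduct.induction_on with
  | zero => exact ⟨0, smul_zero _⟩
  | tmul x y =>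
    obtain ⟨m, hm⟩ := h y
    exact ⟨m, by rw [← TensorProduct.tmul_smul, hm, TensorProduct.tmul_zero]⟩
  | add x y hx hy =>
    obtain ⟨m, hm⟩ := hx
    obtain ⟨n, hn⟩ := hy
    exact ⟨m + n, by rw [smul_add, pow_add, mul_smul, mul_smul, hn, smul_comm, hm]; simp⟩

theorem IsPowTorsion.of_injective {s : R} (h : IsPowTorsion s M) {f : M' →ₗ[R] M}
    (hf : Function.Injective f) : IsPowTorsion s M' := fun x => by
  obtain ⟨m, hm⟩ := h (f x)
  exact ⟨m, hf (by rw [map_smul, hm, map_zero])⟩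

theorem IsPowTorsion.of_surjective {s : R} (h : IsPowTorsion s M) {f : M →ₗ[R] M'}
    (hf : Function.Surjective f) : IsPowTorsion s M' := fun x => by
  obtain ⟨x, rfl⟩ := hf x
  obtain ⟨m, hm⟩ := h x
  exact ⟨m, by rw [← map_smul, hm, map_zero]⟩

theorem IsPowTorsion.tor {s : R} (h : IsPowTorsion s L) (ρ : FlatRes R) (k : ℕ) :
    IsPowTorsion s (ρ.tor k L) :=
  (h.tensorProduct (L := ρ.X k)).of_injective (f := (ρ.tor k L).subtype) Subtype.val_injective

theorem IsPowTorsion.eq_zero {s : R} (h : IsPowTorsion s M)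
    (hs : Function.Injective (fun x : M => s • x)) (x : M) : x = 0 := by
  obtain ⟨m, hm⟩ := h x
  induction m with
  | zero => simpa using hm
  | succ m ih =>
    rw [pow_succ', mul_smul] at hm
    exact ih (hs (by simpa using hm))

theorem smul_bijective_tor {s : R} (hs : Function.Bijective (fun x : L => s • x)) (ρ : FlatRes R)
    (k : ℕ) : Function.Bijective (fun x : ρ.tor k L => s • x) := by
  let e : L ≃ₗ[R] L := LinearEquiv.ofBijective (s • LinearMap.id) hs
  have : (fun x : ρ.tor k L => s • x) = ρ.torEquiv k e := by
    ext1 x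
    exact (ρ.torMap_smul_id k s x).symm
  rw [this]
  exact (ρ.torEquiv k e).bijective

theorem torVanishes_of_powTorsion {s : R} (hM : IsPowTorsion s M)
    (hL : Function.Bijective (fun x : L => s • x)) : TorVanishes R k M L := by
  obtain ⟨e⟩ := nonempty_freeRes_tor_symm R M L k
  rw [torVanishes_iff_subsingleton]
  exact subsingleton_of_forall_eq 0
    (((hM.tor _ k).of_injective e.injective).eq_zero (smul_bijective_tor hL _ k).1)

theorem torVanishes_of_fg (h : ∀ L' : Submodule R L, L'.FG → TorVanishes R k M L') :
    TorVanishes R k M L := by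
  rw [torVanishes_iff_subsingleton]
  refine subsingleton_of_forall_eq 0 fun z => ?_
  obtain ⟨L', hL', hz⟩ := TensorProduct.exists_finite_submodule_right_of_setFinite {z.1}
    (Set.finite_singleton z.1)
  obtain ⟨y, hy⟩ := hz rfl
  have hy' : y ∈ (FlatRes.freeRes (R := R) M).tor k L' :=
    FlatRes.mem_tor_of_lTensor_mem _ L'.injective_subtype (by rw [hy]; exact z.2)
  rw [h L' (Module.Finite.iff_fg.1 hL'), Submodule.mem_bot] at hy'
  ext
  rw [← hy, hy', map_zero]; rfl

end TorVanishes

section HomInjective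

open TensorProduct

variable {R : Type u} [CommRing R] {A B C J X : Type u} [AddCommGroup A] [AddCommGroup B]
  [AddCommGroup C] [AddCommGroup J] [AddCommGroup X] [Module R A] [Module R B] [Module R C]
  [Module R J] [Module R X]

/-- Maps into an injective module factor through any map with small enough kernel. -/
theorem Module.Injective.exists_factor [Module.Injective R J] (g : B →ₗ[R] C) (h : B →ₗ[R] J)
    (hgh : ∀ x, g x = 0 → h x = 0) : ∃ h' : C →ₗ[R] J, h' ∘ₗ g = h := by
  obtain ⟨h', hh'⟩ := Module.Injective.out (Q := J) ((LinearMap.ker g).liftQ g le_rfl)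
    (LinearMap.ker_eq_bot.1 (Submodule.ker_liftQ_eq_bot _ _ _ le_rfl))
    ((LinearMap.ker g).liftQ h hgh)
  exact ⟨h', LinearMap.ext fun x => hh' (Submodule.Quotient.mk x)⟩

theorem lcomp_injective (J : Type u) [AddCommGroup J] [Module R J] {g : B →ₗ[R] C}
    (hg : Function.Surjective g) : Function.Injective (LinearMap.lcomp R J g) := fun x y h =>
  LinearMap.ext fun c => by
    obtain ⟨b, rfl⟩ := hg c
    exact LinearMap.congr_fun h b

theorem lcomp_surjective (J : Type u) [AddCommGroup J] [Module R J] [Module.Injective R J]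
    {f : A →ₗ[R] B} (hf : Function.Injective f) : Function.Surjective (LinearMap.lcomp R J f) :=
  fun h => Module.Injective.exists_factor f h fun x hx => by
    rw [hf (hx.trans (map_zero f).symm), map_zero]

theorem lcomp_exact (J : Type u) [AddCommGroup J] [Module R J]
    {f : A →ₗ[R] B} {g : B →ₗ[R] C} (hg : Function.Surjective g) (hfg : Function.Exact f g) :
    Function.Exact (LinearMap.lcomp R J g) (LinearMap.lcomp R J f) := by
  intro h
  constructor
  · intro hh
    have hk : LinearMap.ker g ≤ LinearMap.ker h := fun x hx => by
      obtain ⟨y, rfl⟩ := (hfg x).1 hx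
      exact LinearMap.congr_fun hh y
    refine ⟨(LinearMap.ker g).liftQ h hk ∘ₗ (g.quotKerEquivOfSurjective hg).symm.toLinearMap, ?_⟩
    ext x
    have : (g.quotKerEquivOfSurjective hg).symm (g x) = Submodule.Quotient.mk x := by
      rw [LinearEquiv.symm_apply_eq]; rfl
    simp [this]
  · rintro ⟨h, rfl⟩
    ext x
    simp [hfg.apply_apply_eq_zero]

/-- The evaluation map `M ⊗ Hom(X, J) → Hom(Hom(M, X), J)`. -/
def homEval (M X J : Type u) [AddCommGroup M] [Module R M] [AddCommGroup X] [Module R X]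
    [AddCommGroup J] [Module R J] : M ⊗[R] (X →ₗ[R] J) →ₗ[R] ((M →ₗ[R] X) →ₗ[R] J) :=
  TensorProduct.lift (LinearMap.mk₂ R (fun m f => f ∘ₗ LinearMap.applyₗ m)
    (fun _ _ _ => by ext; simp) (fun _ _ _ => by ext; simp) (fun _ _ _ => by ext; simp)
    (fun _ _ _ => by ext; simp))

@[simp] theorem homEval_tmul (m : A) (f : X →ₗ[R] J) (φ : A →ₗ[R] X) :
    homEval A X J (m ⊗ₜ f) φ = f (φ m) := rfl

theorem homEval_rTensor (g : A →ₗ[R] B) (z : A ⊗[R] (X →ₗ[R] J)) :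
    homEval B X J (g.rTensor _ z) = homEval A X J z ∘ₗ LinearMap.lcomp R X g := by
  induction z using TensorProduct.induction_on with
  | zero => simp
  | tmul x y => ext; simp
  | add x y hx hy => rw [map_add, map_add, hx, hy, map_add, LinearMap.add_comp]

theorem homEval_bijective_pi (n : ℕ) (X J : Type u) [AddCommGroup X] [Module R X]
    [AddCommGroup J] [Module R J] : Function.Bijective (homEval (R := R) (Fin n → R) X J) := by
  classical
  let φ (i : Fin n) : X →ₗ[R] (Fin n → R) →ₗ[R] X := LinearMap.smulRightₗ (LinearMap.proj i)
  have hφ (i : Fin n) (x : X) (v : Fin n → R) : φ i x v = v i • x := rfl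
  let s (f : Fin n → (X →ₗ[R] J)) : (Fin n → R) ⊗[R] (X →ₗ[R] J) :=
    ∑ i, (Pi.single i 1 : Fin n → R) ⊗ₜ[R] f i
  have hs (f : Fin n → (X →ₗ[R] J)) (ψ : (Fin n → R) →ₗ[R] X) :
      homEval _ X J (s f) ψ = ∑ i, f i (ψ (Pi.single i 1)) := by
    simp only [s, map_sum, LinearMap.sum_apply, homEval_tmul]
  constructor
  · rw [injective_iff_map_eq_zero]
    intro z hz
    obtain ⟨f, rfl⟩ : ∃ f, s f = z := by
      clear hz
      induction z using TensorProduct.induction_on with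
      | zero => exact ⟨0, by simp [s]⟩
      | tmul v f =>
        refine ⟨fun i => v i • f, ?_⟩
        simp only [s, TensorProduct.tmul_smul, TensorProduct.smul_tmul', ← TensorProduct.sum_tmul]
        congr 1
        ext j
        simp [Pi.single_apply]
      | add x y hx hy =>
        obtain ⟨f, rfl⟩ := hx
        obtain ⟨g, rfl⟩ := hy
        exact ⟨f + g, by simp [s, TensorProduct.tmul_add, Finset.sum_add_distrib]⟩
    have : f = 0 := by
      ext j x
      have h := LinearMap.congr_fun hz (φ j x)
      rw [hs] at h
      simpa [hφ, Pi.single_apply, apply_ite] using h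
    rw [this]
    simp [s]
  · intro h
    refine ⟨s fun i => h ∘ₗ φ i, LinearMap.ext fun ψ => ?_⟩
    rw [hs]
    simp only [LinearMap.comp_apply, ← map_sum]
    congr 1
    refine LinearMap.pi_ext' fun i => LinearMap.ext_ring ?_
    simp [hφ, Pi.single_apply]

theorem homEval_bijective [IsNoetherianRing R] [Module.Finite R A] [Module.Injective R J] :
    Function.Bijective (homEval (R := R) A X J) := by
  obtain ⟨n, π, hπ⟩ := Module.Finite.exists_fin' R A
  obtain ⟨m, π', hπ'⟩ := Module.Finite.exists_fin' R (LinearMap.ker π)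
  let a : (Fin m → R) →ₗ[R] (Fin n → R) := (LinearMap.ker π).subtype ∘ₗ π'
  have ha : Function.Exact a π := fun x =>
    ⟨fun hx => by obtain ⟨y, hy⟩ := hπ' ⟨x, hx⟩; exact ⟨y, congrArg Subtype.val hy⟩,
      by rintro ⟨y, rfl⟩; exact (π' y).2⟩
  constructor
  · rw [injective_iff_map_eq_zero]
    intro w hw
    obtain ⟨z, rfl⟩ := LinearMap.rTensor_surjective _ hπ w
    rw [homEval_rTensor] at hw
    obtain ⟨h, hh⟩ := Module.Injective.exists_factor (LinearMap.lcomp R X a)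
      (homEval _ X J z) (fun x hx => by
        obtain ⟨y, rfl⟩ := (lcomp_exact X hπ ha x).1 hx
        exact LinearMap.congr_fun hw y)
    obtain ⟨z', rfl⟩ := (homEval_bijective_pi m X J).2 h
    rw [← homEval_rTensor] at hh
    rw [← (homEval_bijective_pi n X J).1 hh, (rTensor_exact _ ha hπ).apply_apply_eq_zero]
  · intro h
    obtain ⟨h', rfl⟩ := lcomp_surjective J (lcomp_injective X hπ) h
    obtain ⟨z, rfl⟩ := (homEval_bijective_pi n X J).2 h'
    exact ⟨π.rTensor _ z, homEval_rTensor _ _⟩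

theorem rTensor_hom_injective [IsNoetherianRing R] [Module.Finite R A] [Module.Finite R B]
    [Module.Injective R J] (i : A →ₗ[R] B) (hi : Function.Surjective (LinearMap.lcomp R X i)) :
    Function.Injective (i.rTensor (X →ₗ[R] J)) := by
  rw [injective_iff_map_eq_zero]
  intro z hz
  apply (homEval_bijective (R := R) (A := A) (X := X) (J := J)).1
  rw [map_zero]
  apply lcomp_injective J hi
  change homEval A X J z ∘ₗ LinearMap.lcomp R X i = _
  rw [← homEval_rTensor, hz]
  simp

instance flat_hom [IsNoetherianRing R] [Module.Injective R X] [Module.Injective R J] :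
    Module.Flat R (X →ₗ[R] J) := by
  rw [Module.Flat.iff_rTensor_injective]
  intro I _
  exact rTensor_hom_injective _ (lcomp_surjective X I.injective_subtype)

theorem InjDimLE.torVanishes [IsNoetherianRing R] [Module.Injective R J] {n : ℕ} :
    ∀ {X : ModuleCat.{u} R}, InjDimLE R n X → ∀ k, n < k → ∀ (G : Type u) [AddCommGroup G]
      [Module R G], TorVanishes R k G (X →ₗ[R] J) := by
  induction n with
  | zero =>
    intro X hX k hk G _ _
    have : Module.Injective R X := hX
    obtain ⟨k, rfl⟩ := Nat.exists_eq_succ_of_ne_zero hk.ne'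
    exact torVanishes_succ_of_flat
  | succ n ih =>
    rintro X ⟨I, hI, i, hi, hX'⟩ k hk G _ _
    obtain ⟨k, rfl⟩ := Nat.exists_eq_succ_of_ne_zero (Nat.ne_zero_of_lt hk)
    refine TorVanishes.right (lcomp_injective J (Submodule.mkQ_surjective _))
      (lcomp_surjective J hi) (lcomp_exact J (Submodule.mkQ_surjective _)
        (LinearMap.exact_map_mkQ_range i)) torVanishes_succ_of_flat (ih hX' k (by omega) G)

theorem torVanishes_hom_of_ext [IsNoetherianRing R] [Module.Finite R A] [Module.Injective R J]
    (h : ∀ i, 1 ≤ i → Subsingleton (ExtM R i A X)) {k : ℕ} (hk : 1 ≤ k) :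
    TorVanishes R k A (X →ₗ[R] J) := by
  obtain ⟨ρ, ⟨e⟩, hfin, hfree⟩ := FlatRes.exists_finite (R := R) A
  rw [torVanishes_iff ρ e]
  obtain ⟨k, rfl⟩ := Nat.exists_eq_add_of_le' hk
  have (j : ℕ) : Module.Finite R (ρ.F j) := by
    obtain ⟨n, ⟨e⟩⟩ := hfree j
    exact Module.Finite.equiv e.symm
  refine LinearMap.ker_eq_bot.2 (rTensor_hom_injective _ fun f => ?_)
  refine ρ.exists_extension_of_ext (fun j => ?_) X k ?_ f
  · obtain ⟨n, ⟨e⟩⟩ := hfree j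
    exact Module.Projective.of_equiv e.symm
  · have := h (k + 1) hk
    exact ((((Ext R (ModuleCat.{u} R) (k + 1)).mapIso e.toModuleIso.op).app
      (ModuleCat.of R X)).toLinearEquiv).symm.subsingleton

theorem nonempty_tensor_hom_equiv [IsNoetherianRing R] [Module.Finite R A] [Module.Injective R J]
    (h : Function.Bijective (fun r : R => (r • LinearMap.id : A →ₗ[R] A))) :
    Nonempty (A ⊗[R] (A →ₗ[R] J) ≃ₗ[R] J) := by
  let e : R ≃ₗ[R] (A →ₗ[R] A) := LinearEquiv.ofBijective
    (LinearMap.toSpanSingleton R (A →ₗ[R] A) LinearMap.id) h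
  exact ⟨LinearEquiv.ofBijective _ homEval_bijective ≪≫ₗ
    LinearEquiv.congrLeft J R e.symm ≪≫ₗ LinearMap.ringLmapEquivSelf R R J⟩

end HomInjective

section ElTors

open TensorProduct

variable {R : Type u} [CommRing R] {M M' J D L : Type u} [AddCommGroup M] [AddCommGroup M']
  [AddCommGroup J] [AddCommGroup D] [AddCommGroup L] [Module R M] [Module R M'] [Module R J]
  [Module R D] [Module R L] {s : R} {p : Ideal R}

theorem Module.Injective.smul_surjective [Module.Injective R J]
    (hs : Function.Injective (fun x : M => s • x)) :
    Function.Surjective (fun f : M →ₗ[R] J => s • f) := fun f => by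
  obtain ⟨h, hh⟩ := Module.Injective.exists_factor (s • LinearMap.id : M →ₗ[R] M) f fun x hx => by
    rw [hs (a₁ := x) (a₂ := 0) (by simpa using hx), map_zero]
  refine ⟨h, LinearMap.ext fun x => ?_⟩
  rw [← hh]
  simp

theorem Module.Injective.smul_bijective [Module.Injective R J]
    (hs : Function.Injective (fun x : J => s • x)) : Function.Bijective (fun x : J => s • x) := by
  refine ⟨hs, fun x => ?_⟩
  obtain ⟨f, hf⟩ := Module.Injective.smul_surjective (J := J) hs (LinearMap.id : J →ₗ[R] J)
  refine ⟨f x, LinearMap.congr_fun hf x⟩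

theorem smul_bijective_hom (hs : Function.Bijective (fun x : J => s • x)) :
    Function.Bijective (fun f : M →ₗ[R] J => s • f) := by
  let e : J ≃ₗ[R] J := LinearEquiv.ofBijective (s • LinearMap.id) hs
  exact (LinearEquiv.congrRight (M := M) e).bijective

theorem IsPowTorsion.hom [Module.Finite R D] (h : IsPowTorsion s M) :
    IsPowTorsion s (D →ₗ[R] M) := by
  intro f
  obtain ⟨S, hS⟩ := Module.Finite.fg_top (R := R) (M := D)
  choose m hm using fun x => h (f x)
  refine ⟨S.sup m, LinearMap.ext_on hS fun x hx => ?_⟩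
  obtain ⟨c, hc⟩ := Nat.exists_eq_add_of_le (Finset.le_sup (f := m) hx)
  rw [LinearMap.smul_apply, hc, pow_add, mul_comm, mul_smul, hm, smul_zero, LinearMap.zero_apply]

/-- Every element is killed by a power of each element of `p`. -/
def ElTors (p : Ideal R) (M : Type*) [AddCommGroup M] [Module R M] : Prop :=
  ∀ a ∈ p, IsPowTorsion a M

theorem ElTors.hom [Module.Finite R D] (h : ElTors p M) : ElTors p (D →ₗ[R] M) :=
  fun a ha => (h a ha).hom

theorem ElTors.of_injective (h : ElTors p M) {f : M' →ₗ[R] M} (hf : Function.Injective f) :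
    ElTors p M' := fun a ha => (h a ha).of_injective hf

theorem ElTors.of_surjective (h : ElTors p M) {f : M →ₗ[R] M'} (hf : Function.Surjective f) :
    ElTors p M' := fun a ha => (h a ha).of_surjective hf

theorem exists_quotient_injective [IsNoetherianRing R] [Nontrivial M] (hp : ElTors p M)
    (hs : ∀ s ∉ p, Function.Injective (fun x : M => s • x)) :
    ∃ f : (R ⧸ p) →ₗ[R] M, Function.Injective f := by
  obtain ⟨q, hq⟩ := associatedPrimes.nonempty R M
  obtain ⟨hq, f, hf⟩ := (isAssociatedPrime_iff_exists_injective_linearMap q M).1 hq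
  have h (r : R) : r ∈ q ↔ r • f 1 = 0 := by
    rw [← map_smul, map_eq_zero_iff f hf, ← Ideal.Quotient.eq_zero_iff_mem, Algebra.smul_def,
      mul_one]
    rfl
  obtain rfl : p = q := by
    refine le_antisymm (fun a ha => ?_) fun s hsq => ?_
    · obtain ⟨m, hm⟩ := hp a ha (f 1)
      exact hq.mem_of_pow_mem m ((h _).2 hm)
    · by_contra hsp
      have h1 : f 1 = 0 := hs s hsp (a₁ := f 1) (a₂ := 0) (by simpa using (h s).1 hsq)
      exact hq.ne_top ((Ideal.eq_top_iff_one _).2 ((h 1).2 (by rw [h1, smul_zero])))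
  exact ⟨f, hf⟩

theorem subsingleton_of_tensorProduct [IsNoetherianRing R] [Module.Finite R D]
    (hD : Module.annihilator R D = ⊥) (h : Subsingleton (D ⊗[R] L)) : Subsingleton L := by
  have hC : Subsingleton (CharacterModule (D ⊗[R] L)) :=
    subsingleton_of_forall_eq 0 fun c => DFunLike.ext _ _ fun z => by
      rw [Subsingleton.elim z 0, map_zero, map_zero]
  have hW : Subsingleton (D →ₗ[R] CharacterModule L) :=
    (CharacterModule.homEquiv (R := R) (A := D) (B := L)).injective.subsingleton
  rcases subsingleton_or_nontrivial (CharacterModule L) with hL | hL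
  · refine subsingleton_of_forall_eq 0 fun x => ?_
    by_contra hx
    obtain ⟨c, hc⟩ := CharacterModule.exists_character_apply_ne_zero_of_ne_zero hx
    exact hc (by rw [Subsingleton.elim c 0]; rfl)
  exfalso
  obtain ⟨q, hq⟩ := associatedPrimes.nonempty R (CharacterModule L)
  obtain ⟨hq, f, hf⟩ := (isAssociatedPrime_iff_exists_injective_linearMap q _).1 hq
  have hnt : Nontrivial (q.ResidueField ⊗[R] D) :=
    (Module.mem_support_iff_nontrivial_residueField_tensorProduct (⟨q, hq⟩ : PrimeSpectrum R)).1
      (by rw [Module.support_eq_zeroLocus, hD]; simp)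
  obtain ⟨v, hv⟩ := exists_ne (0 : q.ResidueField ⊗[R] D)
  obtain ⟨φ, hφ⟩ : ∃ φ : Module.Dual q.ResidueField (q.ResidueField ⊗[R] D), φ v ≠ 0 := by
    by_contra! hh
    exact hv ((Module.forall_dual_apply_eq_zero_iff q.ResidueField v).1 hh)
  let g : D →ₗ[R] q.ResidueField :=
    (φ.restrictScalars R) ∘ₗ TensorProduct.mk R q.ResidueField D 1
  have hg : g ≠ 0 := fun h0 => hφ (by
    rw [show φ = 0 from by
      ext d
      simpa [g] using LinearMap.congr_fun h0 d]
    rfl)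
  obtain ⟨S, hS⟩ := Module.Finite.fg_top (R := R) (M := D)
  classical
  obtain ⟨b, hb⟩ := IsLocalization.exist_integer_multiples_of_finset (nonZeroDivisors (R ⧸ q))
    (S.image g)
  let i : (R ⧸ q) →ₗ[R] q.ResidueField :=
    (Algebra.linearMap (R ⧸ q) q.ResidueField).restrictScalars R
  have hi : Function.Injective i := IsFractionRing.injective (R ⧸ q) q.ResidueField
  let mb : q.ResidueField →ₗ[R] q.ResidueField :=
    (LinearMap.lsmul (R ⧸ q) q.ResidueField (b : R ⧸ q)).restrictScalars R
  have hr : ∀ d, (mb ∘ₗ g) d ∈ LinearMap.range i := by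
    have : ⊤ ≤ (LinearMap.range i).comap (mb ∘ₗ g) := by
      rw [← hS, Submodule.span_le]
      intro x hx
      exact hb (g x) (Finset.mem_image_of_mem g hx)
    exact fun d => this trivial
  let g' : D →ₗ[R] R ⧸ q := (LinearEquiv.ofInjective i hi).symm.toLinearMap ∘ₗ
    (mb ∘ₗ g).codRestrict _ hr
  have hg' (d : D) : i (g' d) = mb (g d) :=
    congrArg Subtype.val ((LinearEquiv.ofInjective i hi).apply_symm_apply _)
  refine hg (LinearMap.ext fun d => ?_)
  have h0 : g' d = 0 := hf (by
    rw [map_zero]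
    exact LinearMap.congr_fun (Subsingleton.elim (f ∘ₗ g') 0) d)
  have h1 : algebraMap (R ⧸ q) q.ResidueField (b : R ⧸ q) * g d = 0 := by
    rw [← Algebra.smul_def]
    exact (hg' d).symm.trans (by rw [h0, map_zero])
  exact (mul_eq_zero.1 h1).resolve_left
    (IsFractionRing.to_map_ne_zero_of_mem_nonZeroDivisors b.2)

theorem annihilator_eq_bot_of_homothety
    (h : Function.Bijective (fun r : R => (r • LinearMap.id : D →ₗ[R] D))) :
    Module.annihilator R D = ⊥ := by
  refine (Submodule.eq_bot_iff _).2 fun r hr => h.1 (LinearMap.ext fun x => ?_)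
  simpa using Module.mem_annihilator.1 hr x

end ElTors

section InjectiveHull

variable {R : Type u} [CommRing R] {p : Ideal R} {Ep : Type u} [AddCommGroup Ep] [Module R Ep]

theorem IsInjectiveHull.exists_smul_eq {N : Type u} [AddCommGroup N] [Module R N]
    {ι : N →ₗ[R] Ep} (hι : ∀ K : Submodule R Ep, K ≠ ⊥ → K ⊓ LinearMap.range ι ≠ ⊥) {x : Ep}
    (hx : x ≠ 0) : ∃ (r : R) (y : N), r • x = ι y ∧ r • x ≠ 0 := by
  obtain ⟨z, ⟨hz, y, hy⟩, hz0⟩ := Submodule.exists_mem_ne_zero_of_ne_bot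
    (hι (Submodule.span R {x}) (by simpa using hx))
  obtain ⟨r, rfl⟩ := Submodule.mem_span_singleton.1 hz
  exact ⟨r, y, hy.symm, hz0⟩

theorem IsInjectiveHull.elTors [IsNoetherianRing R] (h : IsInjectiveHull R (R ⧸ p) Ep) :
    ElTors p Ep := by
  obtain ⟨-, ι, -, hess⟩ := h
  intro a ha x
  let c : ℕ →o Ideal R := ⟨fun m => LinearMap.ker (LinearMap.toSpanSingleton R Ep (a ^ m • x)),
    monotone_nat_of_le_succ fun m r hr => by
      rw [LinearMap.mem_ker, LinearMap.toSpanSingleton_apply] at hr ⊢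
      rw [pow_succ', mul_smul, smul_comm, hr, smul_zero]⟩
  obtain ⟨m, hm⟩ := monotone_stabilizes_iff_noetherian.2 ‹IsNoetherianRing R› c
  refine ⟨m, ?_⟩
  by_contra hx
  obtain ⟨r, y, hy, h0⟩ := IsInjectiveHull.exists_smul_eq hess hx
  obtain ⟨y, rfl⟩ := Ideal.Quotient.mk_surjective y
  have h1 : r ∈ c (m + 1) := by
    change r • a ^ (m + 1) • x = 0
    rw [pow_succ', mul_smul, smul_comm, hy, ← map_smul, Algebra.smul_def]
    change ι (Ideal.Quotient.mk p a * _) = 0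
    rw [Ideal.Quotient.eq_zero_iff_mem.2 ha, zero_mul, map_zero]
  rw [← hm (m + 1) (Nat.le_succ m)] at h1
  exact h0 h1

theorem IsInjectiveHull.smul_bijective [hp : p.IsPrime] (h : IsInjectiveHull R (R ⧸ p) Ep) {s : R}
    (hs : s ∉ p) : Function.Bijective (fun x : Ep => s • x) := by
  obtain ⟨hinj, ι, hι, hess⟩ := h
  refine Module.Injective.smul_bijective ((injective_iff_map_eq_zero
    (LinearMap.lsmul R Ep s)).2 fun x hx => ?_)
  by_contra hx0
  obtain ⟨r, y, hy, h0⟩ := IsInjectiveHull.exists_smul_eq hess hx0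
  refine h0 ?_
  have h1 : s • y = 0 := hι (by
    rw [map_smul, ← hy, smul_comm, show s • x = 0 from hx, smul_zero, map_zero])
  rw [Algebra.smul_def, mul_eq_zero] at h1
  rw [hy, h1.resolve_left (fun h => hs (Ideal.Quotient.eq_zero_iff_mem.1 h)), map_zero]

end InjectiveHull

section CoReg

open TensorProduct RingTheory.Sequence
open scoped Pointwise

variable {R : Type u} [CommRing R] {M M' J D L N : Type u} [AddCommGroup M] [AddCommGroup M']
  [AddCommGroup J] [AddCommGroup D] [AddCommGroup L] [AddCommGroup N] [Module R M] [Module R M']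
  [Module R J] [Module R D] [Module R L] [Module R N] {k : ℕ}

/-- Coregular sequences: `x₁` is surjective on `M`, `x₂` on the kernel of `x₁`, and so on. -/
def CoReg : List R → ∀ (M : Type u) [AddCommGroup M] [Module R M], Prop
  | [], _, _, _ => True
  | x :: xs, M, _, _ => Function.Surjective (fun m : M => x • m) ∧
      CoReg xs (LinearMap.ker (LinearMap.lsmul R M x))

theorem nonempty_ker_lsmul_equiv (e : M ≃ₗ[R] M') (x : R) :
    Nonempty (LinearMap.ker (LinearMap.lsmul R M x) ≃ₗ[R]
      LinearMap.ker (LinearMap.lsmul R M' x)) := by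
  refine ⟨LinearEquiv.ofSubmodules e _ _ ?_⟩
  ext y
  simp only [Submodule.mem_map, LinearMap.mem_ker, LinearMap.lsmul_apply]
  constructor
  · rintro ⟨z, hz, rfl⟩
    rw [LinearEquiv.coe_coe, ← map_smul, hz, map_zero]
  · intro hy
    exact ⟨e.symm y, by rw [← map_smul, hy, map_zero], e.apply_symm_apply y⟩

theorem CoReg.congr {xs : List R} : ∀ {M M' : Type u} [AddCommGroup M] [AddCommGroup M']
    [Module R M] [Module R M'], CoReg xs M → (M ≃ₗ[R] M') → CoReg xs M' := by
  induction xs with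
  | nil => intros; trivial
  | cons x xs ih =>
    rintro M M' _ _ _ _ ⟨hx, h⟩ e
    obtain ⟨e'⟩ := nonempty_ker_lsmul_equiv e x
    refine ⟨fun y => ?_, ih h e'⟩
    obtain ⟨z, hz⟩ := hx (e.symm y)
    exact ⟨e z, by rw [← e.apply_symm_apply y, ← hz, map_smul]⟩

theorem coReg_hom (J : Type u) [AddCommGroup J] [Module R J] [Module.Injective R J] {xs : List R} :
    ∀ {M : Type u} [AddCommGroup M] [Module R M], IsWeaklyRegular M xs →
      CoReg xs (M →ₗ[R] J) := by
  induction xs with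
  | nil => intros; trivial
  | cons x xs ih =>
    intro M _ _ h
    obtain ⟨hx, h⟩ := (isWeaklyRegular_cons_iff M x xs).1 h
    refine ⟨Module.Injective.smul_surjective hx, (ih h).congr ?_⟩
    refine LinearEquiv.ofInjective (LinearMap.lcomp R J (x • (⊤ : Submodule R M)).mkQ)
      (lcomp_injective J (Submodule.mkQ_surjective _)) ≪≫ₗ LinearEquiv.ofEq _ _ ?_
    ext f
    constructor
    · rintro ⟨f, rfl⟩
      ext m
      change x • f (Submodule.Quotient.mk m) = 0
      rw [← map_smul, ← Submodule.Quotient.mk_smul, (Submodule.Quotient.mk_eq_zero _).2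
        (Submodule.smul_mem_pointwise_smul m x ⊤ trivial), map_zero]
    · intro hf
      refine ⟨(x • (⊤ : Submodule R M)).liftQ f ?_, LinearMap.ext fun m => rfl⟩
      rintro _ ⟨m, -, rfl⟩
      change f (x • m) = 0
      rw [map_smul]
      exact LinearMap.congr_fun hf m

theorem smul_tensorProduct_eq_zero {x : R} (h : ∀ l : L, x • l = 0) (z : M ⊗[R] L) :
    x • z = 0 := by
  induction z using TensorProduct.induction_on with
  | zero => exact smul_zero x
  | tmul m l => rw [← tmul_smul, h, tmul_zero]
  | add a b ha hb => rw [smul_add, ha, hb, add_zero]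

theorem exact_ker_lsmul (N : Type u) [AddCommGroup N] [Module R N] (x : R) :
    Function.Exact (LinearMap.ker (LinearMap.lsmul R N x)).subtype (LinearMap.lsmul R N x) :=
  LinearMap.exact_subtype_ker_map _

theorem CoReg.torVanishes {xs : List R} : ∀ {N : Type u} [AddCommGroup N] [Module R N] {k : ℕ},
    CoReg xs N → (∀ x ∈ xs, ∀ l : L, x • l = 0) → k < xs.length → TorVanishes R k L N := by
  induction xs with
  | nil => intro N _ _ k _ _ hk; exact absurd hk (Nat.not_lt_zero k)
  | cons x xs ih =>
    rintro N _ _ k ⟨hx, h⟩ hL hk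
    have hx0 := hL x (List.mem_cons_self ..)
    rw [torVanishes_iff_subsingleton]
    have hkill (z : (FlatRes.freeRes (R := R) L).tor k N) : x • z = 0 := by
      obtain ⟨e⟩ := nonempty_freeRes_tor_symm R L N k
      refine e.injective (Subtype.ext ?_)
      rw [map_smul, map_zero]
      exact smul_tensorProduct_eq_zero hx0 _
    have hsurj : Function.Surjective
        ((FlatRes.freeRes (R := R) L).torMap k (LinearMap.lsmul R N x)) := by
      cases k with
      | zero =>
        rintro ⟨z, hz⟩
        obtain ⟨y, rfl⟩ := LinearMap.lTensor_surjective (g := LinearMap.lsmul R N x)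
          ((FlatRes.freeRes (R := R) L).X 0) hx z
        exact ⟨⟨y, trivial⟩, rfl⟩
      | succ k =>
        have h0 : TorVanishes R k L (LinearMap.ker (LinearMap.lsmul R N x)) :=
          ih h (fun y hy => hL y (List.mem_cons_of_mem _ hy))
            (by simpa using hk)
        rw [torVanishes_iff_subsingleton] at h0
        exact FlatRes.torMap_surjective _ (Submodule.injective_subtype _) hx
          (exact_ker_lsmul N x) (Function.injective_of_subsingleton _)
    refine subsingleton_of_forall_eq 0 fun z => ?_
    obtain ⟨y, rfl⟩ := hsurj z
    rw [show LinearMap.lsmul R N x = x • LinearMap.id from rfl, FlatRes.torMap_smul_id, hkill]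

theorem CoReg.of_tensorProduct [IsNoetherianRing R] [Module.Finite R D]
    (hD : Module.annihilator R D = ⊥) {xs : List R} :
    ∀ {N : Type u} [AddCommGroup N] [Module R N], CoReg xs (D ⊗[R] N) →
      (∀ k, 1 ≤ k → TorVanishes R k D N) → CoReg xs N := by
  induction xs with
  | nil => intros; trivial
  | cons x xs ih =>
    rintro N _ _ ⟨hx, h⟩ hT
    have hsurj : Function.Surjective (LinearMap.lsmul R N x) := by
      let C := N ⧸ LinearMap.range (LinearMap.lsmul R N x)
      have hC (c : C) : x • c = 0 := by
        obtain ⟨n, rfl⟩ := Submodule.mkQ_surjective _ c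
        rw [← map_smul]
        exact (Submodule.Quotient.mk_eq_zero _).2 ⟨n, rfl⟩
      have hDC : Subsingleton (D ⊗[R] C) := by
        refine subsingleton_of_forall_eq 0 fun z => ?_
        obtain ⟨y, rfl⟩ := LinearMap.lTensor_surjective D (Submodule.mkQ_surjective _) z
        obtain ⟨y, rfl⟩ := hx y
        rw [map_smul, smul_tensorProduct_eq_zero hC]
      have := subsingleton_of_tensorProduct hD hDC
      exact LinearMap.range_eq_top.1 (Submodule.Quotient.subsingleton_iff.1 this)
    have hex := exact_ker_lsmul N x
    refine ⟨hsurj, ih (h.congr ?_) fun k hk =>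
      (hT k hk).left (Submodule.injective_subtype _) hsurj hex (hT (k + 1) (by omega))⟩
    have hinj : Function.Injective
        ((LinearMap.ker (LinearMap.lsmul R N x)).subtype.lTensor D) :=
      (FlatRes.freeRes (R := R) D).lTensor_injective (k := 0) (Submodule.injective_subtype _)
        hsurj hex (hT 1 le_rfl)
    refine (LinearEquiv.ofInjective _ hinj ≪≫ₗ LinearEquiv.ofEq _ _ ?_).symm
    rw [← LinearMap.exact_iff.1 (lTensor_exact D hex hsurj),
      show LinearMap.lsmul R N x = x • LinearMap.id from rfl, LinearMap.lTensor_smul,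
      LinearMap.lTensor_id]
    rfl

theorem torVanishes_quotient_ofList {xs : List R} : ∀ {M : Type u} [AddCommGroup M] [Module R M]
    {m : ℕ}, IsWeaklyRegular M xs → (∀ k, m < k → TorVanishes R k N M) →
      ∀ k, m + xs.length < k →
        TorVanishes R k N (M ⧸ (Ideal.ofList xs • ⊤ : Submodule R M)) := by
  induction xs with
  | nil =>
    intro M _ _ m _ hm k hk
    exact (hm k hk).congr_right (Submodule.quotEquivOfEqBot _ (by simp)).symm
  | cons x xs ih =>
    intro M _ _ m h hm k hk
    obtain ⟨hx, h⟩ := (isWeaklyRegular_cons_iff M x xs).1 h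
    refine (ih (m := m + 1) h (fun j hj => ?_) k (by simp at hk; omega)).congr_right
      (Submodule.quotOfListConsSMulTopEquivQuotSMulTopInner M x xs).symm
    obtain ⟨j, rfl⟩ := Nat.exists_eq_add_of_lt hj
    refine TorVanishes.right (f := LinearMap.lsmul R M x) (g := (x • (⊤ : Submodule R M)).mkQ)
      hx (Submodule.mkQ_surjective _) (fun y => ?_) (hm _ (by omega)) (hm _ (by omega))
    change Submodule.Quotient.mk y = 0 ↔ _
    rw [Submodule.Quotient.mk_eq_zero, Submodule.mem_smul_pointwise_iff_exists]
    simp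

end CoReg

section Filtration

variable {R : Type u} [CommRing R] [IsNoetherianRing R] {p : Ideal R} {N : Type u} [AddCommGroup N]
  [Module R N] (hN : ∀ s ∉ p, Function.Bijective (fun x : N => s • x)) {k : ℕ}
include hN

theorem torVanishes_of_elTors [hp : p.IsPrime] (h : TorVanishes R k N (R ⧸ p)) {L : Type u}
    [AddCommGroup L] [Module R L] (hL : ElTors p L) : TorVanishes R k N L := by
  refine torVanishes_of_fg fun L' hL' => ?_
  have hfin : Module.Finite R L' := Module.Finite.iff_fg.2 hL'
  refine IsNoetherianRing.induction_on_isQuotientEquivQuotientPrime R hfin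
    (motive := fun K _ _ _ => ElTors p K → TorVanishes R k N K) ?_ ?_ ?_
    (hL.of_injective L'.injective_subtype)
  · intro K _ _ _ _ _
    exact torVanishes_of_subsingleton
  · intro K _ _ _ q e hK
    have hq (r : R) : Ideal.Quotient.mk q.asIdeal r = 0 ↔ r ∈ q.asIdeal :=
      Ideal.Quotient.eq_zero_iff_mem
    replace hK : ElTors p (R ⧸ q.asIdeal) := hK.of_surjective e.surjective
    have hpq : p ≤ q.asIdeal := fun a ha => by
      obtain ⟨m, hm⟩ := hK a ha 1
      rw [Algebra.smul_def, mul_one] at hm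
      exact q.2.mem_of_pow_mem m ((hq _).1 hm)
    rcases hpq.eq_or_lt with hpq | hpq
    · subst hpq
      exact h.congr_right e.symm
    · obtain ⟨s, hsq, hsp⟩ := Set.exists_of_ssubset hpq
      refine (torVanishes_of_powTorsion (s := s) (fun x => ⟨1, ?_⟩) (hN s hsp)).symm.congr_right
        e.symm
      rw [pow_one, Algebra.smul_def]
      exact mul_eq_zero_of_left ((hq s).2 hsq) _
  · intro K₁ _ _ _ K₂ _ _ _ K₃ _ _ _ f g hf hg hfg h₁ h₃ hK
    exact (h₁ (hK.of_injective hf)).mid hf hg hfg (h₃ (hK.of_surjective hg))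

/-- Tor-vanishing above `d` on all `p`-torsion modules follows from Tor-vanishing above `d` on
one test module, provided Tor vanishes in all large degrees. -/
theorem torVanishes_of_test [hp : p.IsPrime] {n d : ℕ}
    (hn : ∀ k, n < k → ∀ (G : Type u) [AddCommGroup G] [Module R G], TorVanishes R k N G)
    {C : Type u} [AddCommGroup C] [Module R C] [Nontrivial C] (hC : ElTors p C)
    (hCs : ∀ s ∉ p, Function.Injective (fun x : C => s • x))
    (hNC : ∀ k, d < k → TorVanishes R k N C) (hk : d < k) {L : Type u} [AddCommGroup L]
    [Module R L] (hL : ElTors p L) : TorVanishes R k N L := by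
  obtain ⟨f, hf⟩ := exists_quotient_injective hC hCs
  suffices H : ∀ j k, n < k + j → d < k → ∀ (L : Type u) [AddCommGroup L] [Module R L],
      ElTors p L → TorVanishes R k N L from H (n + 1) k (by omega) hk L hL
  intro j
  induction j with
  | zero => intro k hnk _ L _ _ _; exact hn k hnk L
  | succ j ih =>
    intro k hnk hk L _ _ hL
    refine torVanishes_of_elTors hN ?_ hL
    exact (hNC k hk).left hf (Submodule.mkQ_surjective (LinearMap.range f))
      (LinearMap.exact_map_mkQ_range f)
      (ih (k + 1) (by omega) (by omega) _ (hC.of_surjective (Submodule.mkQ_surjective _)))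

end Filtration

section PowTorsion

variable {R : Type u} [CommRing R] [IsNoetherianRing R] {E L N : Type u} [AddCommGroup E]
  [AddCommGroup L] [AddCommGroup N] [Module R E] [Module R L] [Module R N]

/-- The submodule of elements killed by a power of `a`. -/
def powTorsion (a : R) (E : Type u) [AddCommGroup E] [Module R E] : Submodule R E where
  carrier := {x | ∃ m : ℕ, a ^ m • x = 0}
  zero_mem' := ⟨0, smul_zero _⟩
  add_mem' := by
    rintro x y ⟨m, hm⟩ ⟨n, hn⟩
    refine ⟨m + n, ?_⟩
    rw [smul_add, pow_add, mul_smul _ _ y, hn, mul_comm, mul_smul, hm, smul_zero, smul_zero,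
      add_zero]
  smul_mem' := by
    rintro r x ⟨m, hm⟩
    exact ⟨m, by rw [smul_comm, hm, smul_zero]⟩

omit [IsNoetherianRing R] in
theorem isPowTorsion_powTorsion (a : R) : IsPowTorsion a (powTorsion a E) := by
  rintro ⟨x, m, hm⟩
  exact ⟨m, Subtype.ext hm⟩

theorem injective_powTorsion [Module.Injective R E] (a : R) :
    Module.Injective R (powTorsion a E) := by
  refine Module.Baer.injective fun I f => ?_
  obtain ⟨n, hn⟩ : ∃ n : ℕ, ∀ x : I, a ^ n • f x = 0 := by
    obtain ⟨n, hn⟩ := (isPowTorsion_powTorsion (E := E) a).hom (D := I) f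
    exact ⟨n, fun x => LinearMap.congr_fun hn x⟩
  let c : ℕ →o Ideal R := ⟨fun m => Submodule.comap (LinearMap.lsmul R R (a ^ m)) I,
    monotone_nat_of_le_succ fun m r hr => by
      change a ^ (m + 1) * r ∈ I
      rw [pow_succ', mul_assoc]
      exact I.mul_mem_left a hr⟩
  obtain ⟨m, hm⟩ := monotone_stabilizes_iff_noetherian.2 ‹IsNoetherianRing R› c
  have hkill (x : I) (hx : (x : R) ∈ Ideal.span {a ^ (n + m)}) : f x = 0 := by
    obtain ⟨y, hy⟩ := Ideal.mem_span_singleton'.1 hx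
    have h1 : y ∈ c (n + m) := by
      change a ^ (n + m) * y ∈ I
      rw [mul_comm, hy]
      exact x.2
    rw [← hm (n + m) (Nat.le_add_left m n)] at h1
    have h2 : x = a ^ n • (⟨a ^ m * y, h1⟩ : I) := Subtype.ext (by
      change (x : R) = a ^ n * (a ^ m * y)
      rw [← hy, pow_add]
      ring)
    rw [h2, map_smul, hn]
  obtain ⟨h, hh⟩ := Module.Injective.exists_factor
    ((Submodule.mkQ (Ideal.span {a ^ (n + m)})) ∘ₗ I.subtype)
    ((powTorsion a E).subtype ∘ₗ f) fun x hx => by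
      rw [LinearMap.comp_apply, hkill x ((Submodule.Quotient.mk_eq_zero _).1 hx), map_zero]
  let g : R →ₗ[R] E := h ∘ₗ Submodule.mkQ (Ideal.span {a ^ (n + m)})
  have hg (r : R) : g r ∈ powTorsion a E := ⟨n + m, by
    rw [← map_smul]
    change h (Submodule.Quotient.mk (a ^ (n + m) * r)) = 0
    rw [(Submodule.Quotient.mk_eq_zero _).2
      (Ideal.mul_mem_right _ _ (Ideal.mem_span_singleton_self _)), map_zero]⟩
  exact ⟨g.codRestrict _ hg, fun x hx => Subtype.ext (LinearMap.congr_fun hh ⟨x, hx⟩)⟩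

theorem exists_powTorsion_complement [Module.Injective R E] (a : R) :
    ∃ (V : Submodule R E) (π : E →ₗ[R] V), (∀ v : V, π v = v) ∧ LinearMap.ker π = powTorsion a E ∧
      Function.Bijective (fun x : V => a • x) := by
  have := injective_powTorsion (E := E) a
  obtain ⟨ρ, hρ⟩ := Module.Injective.exists_factor (powTorsion a E).subtype
    (LinearMap.id : powTorsion a E →ₗ[R] powTorsion a E) fun x hx => Subtype.ext hx
  replace hρ (x : powTorsion a E) : ρ x = x := LinearMap.congr_fun hρ x
  let q : E →ₗ[R] E := LinearMap.id - (powTorsion a E).subtype ∘ₗ ρ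
  have hq (x : E) : q x = x - (ρ x : E) := rfl
  have hqker (x : E) : q x ∈ LinearMap.ker ρ := by
    rw [LinearMap.mem_ker, hq, map_sub, hρ, sub_self]
  have hπ (v : LinearMap.ker ρ) : q v = v := by
    rw [hq, LinearMap.mem_ker.1 v.2, ZeroMemClass.coe_zero, sub_zero]
  have hinj : Function.Injective (fun x : LinearMap.ker ρ => a • x) :=
    (injective_iff_map_eq_zero (LinearMap.lsmul R (LinearMap.ker ρ) a)).2 fun x hx => by
      have hx' : (x : E) ∈ powTorsion a E := ⟨1, by
        rw [pow_one]; exact congrArg Subtype.val hx⟩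
      have := hρ ⟨x, hx'⟩
      exact Subtype.ext ((congrArg Subtype.val this).symm.trans
        (congrArg Subtype.val (LinearMap.mem_ker.1 x.2)))
  refine ⟨LinearMap.ker ρ, q.codRestrict _ hqker, fun v => Subtype.ext (hπ v), ?_, hinj,
    fun x => ?_⟩
  · rw [LinearMap.ker_codRestrict]
    ext x
    rw [LinearMap.mem_ker, hq, sub_eq_zero]
    exact ⟨fun h => h ▸ (ρ x).2, fun h => (congrArg Subtype.val (hρ ⟨x, h⟩)).symm⟩
  · obtain ⟨h, hh⟩ := Module.Injective.smul_surjective (J := E) hinj (LinearMap.ker ρ).subtype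
    refine ⟨⟨q (h x), hqker _⟩, Subtype.ext ?_⟩
    change a • q (h x) = x
    rw [← map_smul, show a • h x = x from LinearMap.congr_fun hh x, hπ]

omit [IsNoetherianRing R] in
theorem elTors_span {S : Set R} (h : ∀ a ∈ S, IsPowTorsion a E) : ElTors (Ideal.span S) E := by
  intro a ha x
  have h1 : Ideal.span S ≤ Ideal.radical (LinearMap.ker (LinearMap.toSpanSingleton R E x)) :=
    Ideal.span_le.2 fun b hb => h b hb x
  exact h1 ha

theorem torVanishes_hom_of_injective {p : Ideal R} {k : ℕ} (hN : ElTors p N)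
    (h : ∀ (L : Type u) [AddCommGroup L] [Module R L], ElTors p L → TorVanishes R k N L)
    [Module.Finite R L] [Module.Injective R E] : TorVanishes R k N (L →ₗ[R] E) := by
  obtain ⟨S, hS⟩ : p.FG := IsNoetherian.noetherian p
  suffices H : ∀ l : List R, (∀ a ∈ l, a ∈ p) → ∀ (E : Type u) [AddCommGroup E] [Module R E]
      [Module.Injective R E], (∀ a ∈ S, a ∈ l ∨ IsPowTorsion a E) →
      TorVanishes R k N (L →ₗ[R] E) from
    H S.toList (fun a ha => hS ▸ Ideal.subset_span (Finset.mem_toList.1 ha)) E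
      fun a ha => Or.inl (Finset.mem_toList.2 ha)
  intro l
  induction l with
  | nil =>
    intro _ E _ _ _ hE
    refine h _ (ElTors.hom ?_)
    rw [← hS]
    exact elTors_span fun a ha => (hE a ha).resolve_left List.not_mem_nil
  | cons a l ih =>
    intro hl E _ _ _ hE
    have := injective_powTorsion (E := E) a
    have h1 : TorVanishes R k N (L →ₗ[R] powTorsion a E) := by
      refine ih (fun b hb => hl b (List.mem_cons_of_mem _ hb)) _ fun b hb => ?_
      rcases hE b hb with hb | hb
      · rcases List.mem_cons.1 hb with rfl | hb
        · exact Or.inr (isPowTorsion_powTorsion b)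
        · exact Or.inl hb
      · exact Or.inr (hb.of_injective (powTorsion a E).injective_subtype)
    obtain ⟨V, π, hπ, hker, hV⟩ := exists_powTorsion_complement (E := E) a
    have h2 : TorVanishes R k N (L →ₗ[R] V) :=
      (torVanishes_of_powTorsion (hN a (hl a (List.mem_cons_self ..))) (smul_bijective_hom hV))
    refine h1.mid (f := LinearMap.compRight R (powTorsion a E).subtype)
      (g := LinearMap.compRight R π) ?_ ?_ ?_ h2
    · intro f g hfg
      ext x
      exact LinearMap.congr_fun hfg x
    · intro f
      exact ⟨V.subtype ∘ₗ f, LinearMap.ext fun x => hπ (f x)⟩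
    · intro f
      constructor
      · intro hf
        have hf' (x : L) : f x ∈ powTorsion a E := by
          rw [← hker]
          exact LinearMap.congr_fun hf x
        exact ⟨f.codRestrict _ hf', LinearMap.ext fun x => rfl⟩
      · rintro ⟨f, rfl⟩
        ext x : 1
        have : (f x : E) ∈ LinearMap.ker π := by
          rw [hker]
          exact (f x).2
        exact this

end PowTorsion

namespace FlatRes

open TensorProduct

variable {R : Type u} [CommRing R] (ρ : FlatRes R) {E A B : Type u} [AddCommGroup E] [Module R E]
  [AddCommGroup A] [Module R A] [AddCommGroup B] [Module R B] (d : ℕ)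

theorem torMap_add (f g : A →ₗ[R] B) : ρ.torMap d (f + g) = ρ.torMap d f + ρ.torMap d g := by
  ext z : 2; simp [LinearMap.lTensor_add]

theorem torMap_smul (r : R) (f : A →ₗ[R] B) : ρ.torMap d (r • f) = r • ρ.torMap d f := by
  ext z : 2; simp [LinearMap.lTensor_smul]

theorem torMap_sum {ι : Type*} (s : Finset ι) (f : ι → (A →ₗ[R] B)) :
    ρ.torMap d (∑ i ∈ s, f i) = ∑ i ∈ s, ρ.torMap d (f i) :=
  map_sum (⟨⟨ρ.torMap d, ρ.torMap_add d⟩, ρ.torMap_smul d⟩ :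
    (A →ₗ[R] B) →ₗ[R] (ρ.tor d A →ₗ[R] ρ.tor d B)) f s

/-- The canonical map `Tor_d(X, Hom(L, E)) → Hom(L, Tor_d(X, E))`. -/
noncomputable def torEval (L E : Type u) [AddCommGroup L] [Module R L]
    [AddCommGroup E] [Module R E] :
    ρ.tor d (L →ₗ[R] E) →ₗ[R] (L →ₗ[R] ρ.tor d E) :=
  LinearMap.mk₂ R (fun z l => ρ.torMap d (LinearMap.applyₗ l) z)
    (fun _ _ _ => map_add _ _ _) (fun _ _ _ => map_smul _ _ _)
    (fun z l l' => by rw [map_add, torMap_add]; rfl)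
    (fun r z l => by rw [map_smul, torMap_smul]; rfl)

theorem torEval_apply (z : ρ.tor d (A →ₗ[R] E)) (a : A) :
    ρ.torEval d A E z a = ρ.torMap d (LinearMap.applyₗ a) z := rfl

theorem torEval_torMap_lcomp (f : A →ₗ[R] B) (z : ρ.tor d (B →ₗ[R] E)) :
    ρ.torEval d A E (ρ.torMap d (LinearMap.lcomp R E f) z) = ρ.torEval d B E z ∘ₗ f := by
  ext1 a
  rw [torEval_apply, LinearMap.comp_apply, torEval_apply, ← LinearMap.comp_apply, ← torMap_comp]
  rfl

theorem torEval_bijective_pi (n : ℕ) (E : Type u) [AddCommGroup E] [Module R E] :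
    Function.Bijective (ρ.torEval d (Fin n → R) E) := by
  classical
  let σ (i : Fin n) : E →ₗ[R] (Fin n → R) →ₗ[R] E := LinearMap.smulRightₗ (LinearMap.proj i)
  let s (f : (Fin n → R) →ₗ[R] ρ.tor d E) : ρ.tor d ((Fin n → R) →ₗ[R] E) :=
    ∑ i, ρ.torMap d (σ i) (f (Pi.single i 1))
  refine Function.bijective_iff_has_inverse.2 ⟨s, fun z => ?_, fun f => ?_⟩
  · have h : ∑ i, σ i ∘ₗ LinearMap.applyₗ (Pi.single i (1 : R)) = LinearMap.id := by
      refine LinearMap.ext fun f => LinearMap.ext fun v => ?_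
      simp only [LinearMap.sum_apply, LinearMap.comp_apply, LinearMap.id_apply,
        LinearMap.applyₗ_apply_apply]
      change ∑ i, v i • f (Pi.single i 1) = f v
      conv_rhs => rw [pi_eq_sum_univ' v, map_sum]
      refine Finset.sum_congr rfl fun i _ => ?_
      rw [← map_smul]
    have h' := congrArg (fun g => ρ.torMap d g z) h
    simp only [torMap_sum, torMap_id, torMap_comp, LinearMap.sum_apply, LinearMap.comp_apply,
      LinearMap.id_apply] at h'
    exact h'
  · refine LinearMap.ext fun v => ?_
    have h (i : Fin n) (y : ρ.tor d E) :
        ρ.torMap d (LinearMap.applyₗ v) (ρ.torMap d (σ i) y) = v i • y := by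
      rw [← torMap_smul_id, ← LinearMap.comp_apply, ← torMap_comp]
      rfl
    rw [torEval_apply, map_sum]
    conv_rhs => rw [pi_eq_sum_univ' v, map_sum]
    exact Finset.sum_congr rfl fun i _ => by rw [h, map_smul]

variable [IsNoetherianRing R] [Module.Injective R E] {d}

theorem torEval_injective
    (h : ∀ (L : Type u) [AddCommGroup L] [Module R L] [Module.Finite R L],
      ρ.tor (d + 1) (L →ₗ[R] E) = ⊥) [Module.Finite R A] :
    Function.Injective (ρ.torEval d A E) := by
  obtain ⟨n, π, hπ⟩ := Module.Finite.exists_fin' R A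
  rw [injective_iff_map_eq_zero]
  intro z hz
  have h1 : Function.Injective (ρ.torMap d (LinearMap.lcomp R E π)) :=
    ρ.torMap_injective (lcomp_injective E hπ)
      (lcomp_surjective E (LinearMap.ker π).injective_subtype)
      (lcomp_exact E hπ (LinearMap.exact_subtype_ker_map π)) (h _)
  refine h1 ((ρ.torEval_bijective_pi d n E).1 ?_)
  rw [torEval_torMap_lcomp, hz, map_zero, map_zero, LinearMap.zero_comp]

theorem torEval_surjective
    (h : ∀ (L : Type u) [AddCommGroup L] [Module R L] [Module.Finite R L],
      ρ.tor (d + 1) (L →ₗ[R] E) = ⊥) [Module.Finite R A] :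
    Function.Surjective (ρ.torEval d A E) := by
  obtain ⟨n, π, hπ⟩ := Module.Finite.exists_fin' R A
  intro f
  have hex := LinearMap.exact_subtype_ker_map π
  obtain ⟨w, hw⟩ := (ρ.torEval_bijective_pi d n E).2 (f ∘ₗ π)
  obtain ⟨z, rfl⟩ := ρ.exact_torMap (lcomp_injective E hπ)
    (lcomp_surjective E (LinearMap.ker π).injective_subtype) (lcomp_exact E hπ hex) d (z := w) (by
      refine ρ.torEval_injective h ?_
      rw [torEval_torMap_lcomp, hw, map_zero, LinearMap.comp_assoc, hex.linearMap_comp_eq_zero,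
        LinearMap.comp_zero])
  refine ⟨z, LinearMap.ext fun a => ?_⟩
  obtain ⟨v, rfl⟩ := hπ a
  rw [torEval_torMap_lcomp] at hw
  exact LinearMap.congr_fun hw v

/-- If `Tor_k(X, Hom(L, E))` vanishes for all finite `L` and all `k ≠ d`, then `Tor_d(X, E)` is
injective. -/
theorem injective_tor (h : ∀ k ≠ d, ∀ (L : Type u) [AddCommGroup L] [Module R L]
    [Module.Finite R L], ρ.tor k (L →ₗ[R] E) = ⊥) : Module.Injective R (ρ.tor d E) := by
  refine Module.Baer.injective fun I f => ?_
  obtain ⟨z, rfl⟩ := ρ.torEval_surjective (fun L _ _ _ => h (d + 1) (Nat.succ_ne_self d) L) f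
  have hs : Function.Surjective (ρ.torMap d (LinearMap.lcomp R E I.subtype)) := by
    have hI := lcomp_surjective (R := R) E I.injective_subtype
    cases d with
    | zero =>
      rintro ⟨z, hz⟩
      obtain ⟨y, rfl⟩ := LinearMap.lTensor_surjective (g := LinearMap.lcomp R E I.subtype)
        (ρ.X 0) hI z
      exact ⟨⟨y, trivial⟩, rfl⟩
    | succ d =>
      have h0 := h d (Nat.succ_ne_self d).symm (R ⧸ I)
      rw [← Submodule.subsingleton_iff_eq_bot] at h0
      exact ρ.torMap_surjective (lcomp_injective E I.mkQ_surjective) hI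
        (lcomp_exact E I.mkQ_surjective (LinearMap.exact_subtype_mkQ I))
        (Function.injective_of_subsingleton _)
  obtain ⟨w, rfl⟩ := hs z
  exact ⟨ρ.torEval d R E w, fun x hx => by rw [torEval_torMap_lcomp]; rfl⟩

end FlatRes

section Decomposition

variable {R : Type u} [CommRing R] [IsNoetherianRing R] {p : Ideal R} {J T : Type u}
  [AddCommGroup J] [AddCommGroup T] [Module R J] [Module R T]

/-- Over a noetherian ring, direct sums of copies of an injective module are injective. -/
theorem injective_finsupp [Module.Injective R J] (S : Type u) :
    Module.Injective R (S →₀ J) := by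
  classical
  refine Module.Baer.injective fun I f => ?_
  choose g hg using fun i : S => (Module.Baer.of_injective ‹_›) I ((Finsupp.lapply i) ∘ₗ f)
  obtain ⟨G, hG⟩ := Module.Finite.fg_top (R := R) (M := I)
  let t : Finset S := G.biUnion fun x => (f x).support
  have ht (x : I) : f x ∈ Finsupp.supported J R (t : Set S) := by
    have h : ⊤ ≤ (Finsupp.supported J R (t : Set S)).comap f := by
      rw [← hG, Submodule.span_le]
      intro x hx
      refine (Finsupp.mem_supported R _).2 (Finset.coe_subset.2 ?_)
      exact Finset.subset_biUnion_of_mem (fun x => (f x).support) hx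
    exact h trivial
  refine ⟨∑ i ∈ t, Finsupp.lsingle i ∘ₗ g i, fun x hx => ?_⟩
  ext j
  simp only [LinearMap.sum_apply, Finsupp.finsetSum_apply, LinearMap.comp_apply,
    Finsupp.lsingle_apply, Finsupp.single_apply, Finset.sum_ite_eq']
  split_ifs with hj
  · exact hg j x hx
  · exact (Finsupp.mem_supported' R _).1 (ht ⟨x, hx⟩) j hj |>.symm

/-- An injective `p`-torsion module on which the elements outside `p` act injectively is a direct
sum of copies of the injective hull of `R/p`. -/
theorem IsInjectiveHull.nonempty_equiv_finsupp {Ep : Type u} [AddCommGroup Ep] [Module R Ep]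
    [Nontrivial (R ⧸ p)] (hEp : IsInjectiveHull R (R ⧸ p) Ep) [Module.Injective R T]
    (hT : ElTors p T) (hTs : ∀ s ∉ p, Function.Injective (fun x : T => s • x)) :
    ∃ μ : Type u, Nonempty (T ≃ₗ[R] (μ →₀ Ep)) := by
  classical
  obtain ⟨hinj, ι, hι, hess⟩ := hEp
  let Φ : ((Ep →ₗ[R] T) →₀ Ep) →ₗ[R] T := Finsupp.lsum R fun f => f
  have hΦ (f : Ep →ₗ[R] T) (e : Ep) : Φ (Finsupp.single f e) = f e := by simp [Φ]
  obtain ⟨S, hS⟩ := zorn_subset {S : Set (Ep →ₗ[R] T) |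
      ∀ v ∈ Finsupp.supported Ep R S, Φ v = 0 → v = 0} fun c hc hchain => by
    rcases c.eq_empty_or_nonempty with rfl | hne
    · refine ⟨∅, fun v hv _ => ?_, by simp⟩
      simpa [Finsupp.mem_supported] using hv
    · refine ⟨⋃₀ c, fun v hv => ?_, fun s => Set.subset_sUnion_of_mem⟩
      rw [Finsupp.mem_supported, Set.sUnion_eq_biUnion] at hv
      obtain ⟨s, hs, hvs⟩ := DirectedOn.exists_mem_subset_of_finset_subset_biUnion hne
        hchain.directedOn hv
      exact hc hs v hvs
  let W := Finsupp.supported Ep R S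
  let ε : W ≃ₗ[R] (S →₀ Ep) := Finsupp.supportedEquivFinsupp S
  have := injective_finsupp (R := R) (J := Ep) S
  have hΦW : Function.Injective (Φ ∘ₗ W.subtype) :=
    (injective_iff_map_eq_zero _).2 fun w hw => Subtype.ext (hS.1 w w.2 hw)
  obtain ⟨r, hr⟩ := Module.Injective.exists_factor (Φ ∘ₗ W.subtype) ε.toLinearMap fun x hx => by
    rw [(map_eq_zero_iff _ hΦW).1 hx, map_zero]
  replace hr (w : W) : r (Φ w) = ε w := LinearMap.congr_fun hr w
  refine ⟨S, ⟨LinearEquiv.ofBijective r ⟨?_, fun w => ⟨Φ (ε.symm w), by simp [hr]⟩⟩⟩⟩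
  rw [← LinearMap.ker_eq_bot]
  by_contra hC
  have := Submodule.nontrivial_iff_ne_bot.2 hC
  obtain ⟨j, hj⟩ := exists_quotient_injective (M := LinearMap.ker r)
    (hT.of_injective (LinearMap.ker r).injective_subtype) fun s hs x y hxy =>
      Subtype.ext (hTs s hs (congrArg Subtype.val hxy))
  obtain ⟨h₀, hh₀⟩ := Module.Injective.exists_factor ι
    ((LinearMap.ker r).subtype ∘ₗ j) fun x hx => by
    rw [(map_eq_zero_iff _ hι).1 hx, map_zero]
  let h : Ep →ₗ[R] T := h₀ - Φ ∘ₗ W.subtype ∘ₗ ε.symm.toLinearMap ∘ₗ r ∘ₗ h₀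
  have hrh (e : Ep) : r (h e) = 0 := by
    change r (h₀ e - Φ (ε.symm (r (h₀ e)))) = 0
    rw [map_sub, hr, LinearEquiv.apply_symm_apply, sub_self]
  have hhι (x : R ⧸ p) : h (ι x) = j x := by
    have h1 : h₀ (ι x) = j x := LinearMap.congr_fun hh₀ x
    change h₀ (ι x) - Φ (ε.symm (r (h₀ (ι x)))) = j x
    rw [h1, LinearMap.mem_ker.1 (j x).2, map_zero, ZeroMemClass.coe_zero, map_zero, sub_zero]
  have hhinj : LinearMap.ker h = ⊥ := by
    by_contra hne
    refine hess _ hne ((Submodule.eq_bot_iff _).2 ?_)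
    rintro _ ⟨hx, x, rfl⟩
    have h1 : j x = 0 := Subtype.ext ((hhι x).symm.trans hx)
    rw [(map_eq_zero_iff _ hj).1 h1, map_zero]
  have hmem : h ∈ S := by
    refine hS.2 (y := insert h S) (fun v hv hv0 => ?_) (Set.subset_insert h S)
      (Set.mem_insert h S)
    have hv' : v.erase h ∈ W := by
      rw [Finsupp.mem_supported] at hv ⊢
      intro f hf
      rw [Finset.mem_coe, Finsupp.support_erase, Finset.mem_erase] at hf
      exact (hv (Finset.mem_coe.2 hf.2)).resolve_left hf.1
    rw [← Finsupp.single_add_erase h v, map_add, hΦ] at hv0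
    have h1 : v.erase h = 0 := by
      have h2 := congrArg r hv0
      rw [map_add, hrh, zero_add, map_zero, hr ⟨_, hv'⟩, map_eq_zero_iff _ ε.injective] at h2
      exact congrArg Subtype.val h2
    rw [h1, map_zero, add_zero, map_eq_zero_iff _ (LinearMap.ker_eq_bot.1 hhinj)] at hv0
    rw [← Finsupp.single_add_erase h v, h1, hv0, Finsupp.single_zero, add_zero]
  have hw : Finsupp.single h (ι 1) ∈ W := Finsupp.single_mem_supported R _ hmem
  have h1 := hr ⟨_, hw⟩
  rw [hΦ, hrh] at h1
  have h2 := congrArg Subtype.val ((map_eq_zero_iff _ ε.injective).1 h1.symm)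
  exact one_ne_zero ((map_eq_zero_iff _ hι).1 (Finsupp.single_eq_zero.1 h2))

end Decomposition

section Localization

open RingTheory.Sequence IsLocalRing
open scoped Pointwise

theorem Ideal.ofList_eq_of_forall₂_associated {A : Type*} [CommRing A] {rs rs' : List A}
    (h : List.Forall₂ Associated rs rs') : Ideal.ofList rs = Ideal.ofList rs' := by
  induction h with
  | nil => rfl
  | cons h _ ih =>
    obtain ⟨v, rfl⟩ := h
    rw [Ideal.ofList_cons, Ideal.ofList_cons, ih, Ideal.span_singleton_mul_right_unit v.isUnit]

theorem RingTheory.Sequence.IsWeaklyRegular.of_forall₂_associated {A : Type*} [CommRing A]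
    {rs rs' : List A} (h : List.Forall₂ Associated rs rs') {M : Type*} [AddCommGroup M]
    [Module A M] (hM : IsWeaklyRegular M rs) : IsWeaklyRegular M rs' := by
  induction h generalizing M with
  | nil => exact .nil A M
  | @cons a b _ _ h _ ih =>
    obtain ⟨h₁, h₂⟩ := (isWeaklyRegular_cons_iff M _ _).1 hM
    obtain ⟨v, rfl⟩ := h
    have hab : a • (⊤ : Submodule A M) = (a * v) • ⊤ := by
      rw [← Submodule.ideal_span_singleton_smul, ← Submodule.ideal_span_singleton_smul,
        Ideal.span_singleton_mul_right_unit v.isUnit]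
    refine .cons ?_ (((Submodule.quotEquivOfEq _ _ hab).isWeaklyRegular_congr _).1 (ih h₂))
    exact h₁.mul (v.isUnit.isSMulRegular M)

variable {R : Type u} [CommRing R] (p : Ideal R) [p.IsPrime]

theorem exists_forall₂_associated_map_algebraMap :
    ∀ rs : List (Localization.AtPrime p),
      (∀ r ∈ rs, r ∈ maximalIdeal (Localization.AtPrime p)) →
        ∃ xs : List R, (∀ x ∈ xs, x ∈ p) ∧
          List.Forall₂ Associated rs (xs.map (algebraMap R (Localization.AtPrime p)))
  | [], _ => ⟨[], by simp, .nil⟩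
  | r :: rs, h => by
    obtain ⟨xs, hxs, hrs⟩ :=
      exists_forall₂_associated_map_algebraMap rs fun a ha => h a (List.mem_cons_of_mem _ ha)
    obtain ⟨⟨x, s⟩, hx⟩ := IsLocalization.surj p.primeCompl r
    refine ⟨x :: xs, List.forall_mem_cons.2 ⟨?_, hxs⟩, .cons ?_ hrs⟩
    · rw [← IsLocalization.AtPrime.to_map_mem_maximal_iff (Localization.AtPrime p) p, ← hx]
      exact Ideal.mul_mem_right _ _ (h r List.mem_cons_self)
    · exact ⟨(IsLocalization.map_units (Localization.AtPrime p) s).unit, hx⟩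

theorem smul_bijective_of_algebra_localization {M : Type*} [AddCommGroup M] [Module R M]
    [Module (Localization.AtPrime p) M] [IsScalarTower R (Localization.AtPrime p) M]
    {s : R} (hs : s ∉ p) : Function.Bijective fun m : M => s • m := by
  have hu : IsUnit (algebraMap R (Localization.AtPrime p) s) :=
    IsLocalization.map_units _ (⟨s, hs⟩ : p.primeCompl)
  have := (Module.End.isUnit_iff _).1 (hu.map (algebraMap (Localization.AtPrime p)
    (Module.End (Localization.AtPrime p) M)))
  convert this using 2 with m
  simp [algebraMap_smul]

theorem nonempty_localization_hom_equiv {J : Type u} [AddCommGroup J] [Module R J]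
    [Module.Injective R J] (hJ : ∀ s ∉ p, Function.Bijective fun j : J => s • j) :
    Nonempty ((Localization.AtPrime p →ₗ[R] J) ≃ₗ[R] J) := by
  refine ⟨.ofBijective (LinearMap.applyₗ 1) ⟨?_, fun e => ?_⟩⟩
  · rw [← LinearMap.ker_eq_bot, LinearMap.ker_eq_bot']
    intro f hf
    ext a
    obtain ⟨⟨r, s⟩, ha⟩ := IsLocalization.surj p.primeCompl a
    refine (hJ s s.2).1 ?_
    have : (s : R) • a = r • (1 : Localization.AtPrime p) := by
      rw [Algebra.smul_def, mul_comm, ha, Algebra.smul_def, mul_one]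
    have hf1 : f 1 = 0 := hf
    simp only [← map_smul, this, LinearMap.zero_apply, smul_zero]
    rw [map_smul, hf1, smul_zero]
  · obtain ⟨f, hf⟩ := Module.Injective.exists_factor
      (Algebra.linearMap R (Localization.AtPrime p)) (LinearMap.toSpanSingleton R J e) <| by
        intro r hr
        obtain ⟨s, hs⟩ := (IsLocalization.map_eq_zero_iff p.primeCompl _ r).1 hr
        refine (hJ s s.2).1 ?_
        simp [← mul_smul, hs]
    refine ⟨f, ?_⟩
    have := LinearMap.congr_fun hf 1
    simpa using this

/-- A maximal regular sequence of a Cohen-Macaulay localization, lifted to the ring. -/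
theorem IsCohenMacaulayRing.exists_isWeaklyRegular [IsNoetherianRing R]
    (hCM : IsCohenMacaulayRing R) :
    ∃ xs : List R, (∀ x ∈ xs, x ∈ p) ∧ (xs.length : ℕ∞) = p.height ∧
      IsWeaklyRegular (Localization.AtPrime p) xs ∧
      Nontrivial (Localization.AtPrime p ⧸
        (Ideal.ofList xs • ⊤ : Submodule R (Localization.AtPrime p))) ∧
      ElTors p (Localization.AtPrime p ⧸
        (Ideal.ofList xs • ⊤ : Submodule R (Localization.AtPrime p))) ∧
      ∀ s ∉ p, Function.Injective fun c : Localization.AtPrime p ⧸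
        (Ideal.ofList xs • ⊤ : Submodule R (Localization.AtPrime p)) => s • c := by
  set A := Localization.AtPrime p
  have hdepth : localRingDepth A = p.height := by
    have := hCM p inferInstance
    rw [IsLocalization.AtPrime.ringKrullDim_eq_height p A] at this
    exact_mod_cast this
  have hmem : localRingDepth A ∈ {n : ℕ∞ | ∃ rs : List A, (∀ r ∈ rs, r ∈ maximalIdeal A) ∧
      IsRegular A rs ∧ (rs.length : ℕ∞) = n} := by
    have : Nonempty {n : ℕ∞ | ∃ rs : List A, (∀ r ∈ rs, r ∈ maximalIdeal A) ∧
        IsRegular A rs ∧ (rs.length : ℕ∞) = n} := ⟨0, [], by simp, .nil A A, by simp⟩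
    refine ENat.sSup_mem_of_nonempty_of_lt_top (?_ : localRingDepth A < ⊤)
    rw [hdepth]
    exact Ideal.height_lt_top (Ideal.IsPrime.ne_top inferInstance)
  obtain ⟨rs, hrs, hreg, hlen⟩ := hmem
  obtain ⟨xs, hxs, hass⟩ := exists_forall₂_associated_map_algebraMap p rs hrs
  have hlen' : xs.length = rs.length := by simpa using hass.length_eq.symm
  have hI : (Ideal.ofList xs • ⊤ : Submodule R A) = (Ideal.ofList rs).restrictScalars R := by
    rw [Ideal.smul_top_eq_map, Ideal.map_ofList, Ideal.ofList_eq_of_forall₂_associated hass]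
  have hne : Ideal.ofList rs ≠ ⊤ := by simpa using hreg.top_ne_smul.symm
  have : Nontrivial (A ⧸ Ideal.ofList rs) := Ideal.Quotient.nontrivial_iff.2 hne
  have : IsLocalRing (A ⧸ Ideal.ofList rs) :=
    .of_surjective' (Ideal.Quotient.mk _) Ideal.Quotient.mk_surjective
  have hdim : ringKrullDim (A ⧸ Ideal.ofList rs) = 0 := by
    have h₁ := ringKrullDim_add_length_eq_ringKrullDim_of_isRegular rs hreg
    rw [IsLocalization.AtPrime.ringKrullDim_eq_height p A, ← hdepth, ← hlen] at h₁
    obtain ⟨n, hn⟩ : ∃ n : ℕ∞, ringKrullDim (A ⧸ Ideal.ofList rs) = n :=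
      ⟨_, (WithBot.coe_unbot _ ringKrullDim_ne_bot).symm⟩
    rw [hn] at h₁ ⊢
    have h₂ : n + (rs.length : ℕ∞) = 0 + (rs.length : ℕ∞) := by rw [zero_add]; exact_mod_cast h₁
    rw [ENat.add_left_injective_of_ne_top (ENat.natCast_ne_top _) h₂]
    rfl
  have : Ring.KrullDimLE 0 (A ⧸ Ideal.ofList rs) :=
    ringKrullDimZero_iff_ringKrullDim_eq_zero.2 hdim
  let e : (A ⧸ (Ideal.ofList xs • ⊤ : Submodule R A)) ≃ₗ[R] A ⧸ Ideal.ofList rs :=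
    Submodule.quotEquivOfEq _ _ hI ≪≫ₗ Submodule.Quotient.restrictScalarsEquiv R _
  refine ⟨xs, hxs, ?_, ?_, e.toEquiv.nontrivial, ElTors.of_injective ?_ e.injective, ?_⟩
  · rw [hlen', hlen, hdepth]
  · exact (isWeaklyRegular_map_algebraMap_iff A A xs).1
      (hreg.toIsWeaklyRegular.of_forall₂_associated hass)
  · intro a ha c
    have ha' : algebraMap R A a ∈ maximalIdeal A :=
      (IsLocalization.AtPrime.to_map_mem_maximal_iff A p a).2 ha
    have : IsLocalHom (Ideal.Quotient.mk (Ideal.ofList rs)) :=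
      .of_surjective _ Ideal.Quotient.mk_surjective
    have : IsNilpotent (algebraMap R (A ⧸ Ideal.ofList rs) a) :=
      Ring.KrullDimLE.isNilpotent_iff_mem_maximalIdeal.2 <| (mem_maximalIdeal _).2 fun hu =>
        (mem_maximalIdeal _).1 ha' (isUnit_of_map_unit (Ideal.Quotient.mk (Ideal.ofList rs)) _ hu)
    obtain ⟨n, hn⟩ := this
    exact ⟨n, (Algebra.smul_def (A := A ⧸ Ideal.ofList rs) (a ^ n) c).trans
      (by rw [map_pow, hn, zero_mul])⟩
  · intro s hs c c' h
    refine e.injective ((smul_bijective_of_algebra_localization p hs).1 ?_)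
    simpa using congrArg e h

end Localization

/-- Over a Cohen-Macaulay noetherian ring with dualizing module `D`, for each
injective module `E` there is an index set `μ_p` such that
`Tor_k^R(Hom_R(D, E_R(R/p)), E)` vanishes for `k ≠ ht p` and is a direct sum of copies of
`E_R(R/p)` indexed by `μ_p` for `k = ht p`. -/
theorem statement9 (R : Type u) [CommRing R] [IsNoetherianRing R]
    (hCM : IsCohenMacaulayRing R)
    (D : Type u) [AddCommGroup D] [Module R D] (hD : IsDualizing R D)
    (p : Ideal R) (hp : p.IsPrime)
    (Ep : Type u) [AddCommGroup Ep] [Module R Ep] (hEp : IsInjectiveHull R (R ⧸ p) Ep)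
    (E : Type u) [AddCommGroup E] [Module R E] (hE : Module.Injective R E) :
    ∃ μ : Type u,
      (∀ k : ℕ, (k : ℕ∞) ≠ Order.height (⟨p, hp⟩ : PrimeSpectrum R) →
        Subsingleton (TorM R k (D →ₗ[R] Ep) E)) ∧
      (∀ k : ℕ, (k : ℕ∞) = Order.height (⟨p, hp⟩ : PrimeSpectrum R) →
        Nonempty ((TorM R k (D →ₗ[R] Ep) E) ≃ₗ[R] (μ →₀ Ep))) := by
  obtain ⟨⟨hfin, hhom, hext⟩, n, hid⟩ := hD
  have hEpi : Module.Injective R Ep := hEp.1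
  obtain ⟨xs, hxs, hlen, hreg, hC, hCp, hCs⟩ := hCM.exists_isWeaklyRegular p
  have hht : Order.height (⟨p, hp⟩ : PrimeSpectrum R) = (xs.length : ℕ∞) := by
    rw [hlen]; exact (PrimeSpectrum.height_eq_orderHeight ⟨p, hp⟩).symm
  set d := xs.length
  have hNs (s : R) (hs : s ∉ p) : Function.Bijective fun f : D →ₗ[R] Ep => s • f :=
    smul_bijective_hom (hEp.smul_bijective hs)
  have hN : ElTors p (D →ₗ[R] Ep) := hEp.elTors.hom
  have hn (k : ℕ) (hk : n < k) (G : Type u) [AddCommGroup G] [Module R G] :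
      TorVanishes R k (D →ₗ[R] Ep) G := (InjDimLE.torVanishes hid k hk G).symm
  have hcoreg : CoReg xs (D →ₗ[R] Ep) := by
    obtain ⟨e₁⟩ := nonempty_localization_hom_equiv p fun s hs => hEp.smul_bijective hs
    obtain ⟨e₂⟩ := nonempty_tensor_hom_equiv (J := Ep) hhom
    exact CoReg.of_tensorProduct (annihilator_eq_bot_of_homothety hhom)
      ((coReg_hom Ep hreg).congr (e₁ ≪≫ₗ e₂.symm))
      fun k hk => torVanishes_hom_of_ext hext hk
  have hquot (k : ℕ) (hk : k < d) : TorVanishes R k (D →ₗ[R] Ep) (R ⧸ p) :=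
    (hcoreg.torVanishes (fun x hx l => by
      obtain ⟨r, rfl⟩ := Ideal.Quotient.mk_surjective l
      exact Ideal.Quotient.eq_zero_iff_mem.2 (Ideal.mul_mem_right _ _ (hxs x hx))) hk).symm
  have hNC (k : ℕ) (hk : d < k) := torVanishes_quotient_ofList (N := D →ₗ[R] Ep) (m := 0) hreg
    (fun k hk => by
      obtain ⟨j, rfl⟩ := Nat.exists_eq_succ_of_ne_zero hk.ne'
      exact torVanishes_succ_of_flat) k (by omega)
  have hvan (k : ℕ) (hk : k ≠ d) (L : Type u) [AddCommGroup L] [Module R L] (hL : ElTors p L) :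
      TorVanishes R k (D →ₗ[R] Ep) L := by
    rcases hk.lt_or_gt with hk | hk
    · exact torVanishes_of_elTors hNs (hquot k hk) hL
    · exact torVanishes_of_test hNs hn hCp hCs hNC hk hL
  have hvanE (k : ℕ) (hk : k ≠ d) (L : Type u) [AddCommGroup L] [Module R L] [Module.Finite R L] :
      TorVanishes R k (D →ₗ[R] Ep) (L →ₗ[R] E) :=
    torVanishes_hom_of_injective hN fun L _ _ hL => hvan k hk L hL
  obtain ⟨φ⟩ := nonempty_freeRes_tor_symm R (D →ₗ[R] Ep) E d
  have := FlatRes.injective_tor (FlatRes.freeRes (R := R) (D →ₗ[R] Ep)) (E := E) (d := d)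
    fun k hk L => hvanE k hk L
  obtain ⟨μ, ⟨e⟩⟩ := hEp.nonempty_equiv_finsupp
    (T := (FlatRes.freeRes (R := R) (D →ₗ[R] Ep)).tor d E)
    (fun a ha => ((hN a ha).tor _ d).of_injective φ.injective)
    (fun s hs x y h => φ.injective ((smul_bijective_tor (hNs s hs) _ d).1 (by
      simpa using congrArg φ h)))
  refine ⟨μ, fun k hk => ?_, fun k hk => ?_⟩
  · have hkd : k ≠ d := fun h => hk (by rw [h, hht])
    obtain ⟨ψ⟩ := nonempty_torM_equiv_freeRes R (D →ₗ[R] Ep) E k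
    have := (torVanishes_iff_subsingleton).1
      ((hvanE k hkd R).congr_right (LinearMap.ringLmapEquivSelf R R E))
    exact ψ.toEquiv.subsingleton
  · obtain rfl : k = d := by rw [hht] at hk; exact_mod_cast hk
    obtain ⟨ψ⟩ := nonempty_torM_equiv_freeRes R (D →ₗ[R] Ep) E d
    exact ⟨ψ ≪≫ₗ e⟩
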